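/- arXiv:1212.0588 — 8 statements merged into one kernel-verified Lean document; each statement's English description precedes it below -/
import Mathlib

section
/- Let n ≥ 3 be a natural number and let K be a field with char K = 0 or char K > 3. Fix a natural number k with 1 < k ≤ n - 1. Let G : M_n(K) → M_n(K) be an additive map such that [G(x), x] = 0 for every rank-k matrix x ∈ M_n(K). Then [G(x), x] = 0 for every matrix x ∈ M_n(K). -/
open Matrix in
/-- A square matrix of rank at most `k` has a complement `a` such that every matrix `a + t • b`
with `t ≠ 0` has rank exactly `k`. -/
theorem Matrix.exists_forall_rank_add_smul_eq {K m : Type*} [Field K] [Fintype m] [DecidableEq m]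
    {k : ℕ} (hk : k ≤ Fintype.card m) (b : Matrix m m K) (hb : b.rank ≤ k) :
    ∃ a : Matrix m m K, ∀ t : K, t ≠ 0 → (a + t • b).rank = k := by
  classical
  obtain ⟨L, L', d, rfl⟩ := Pivot.exists_list_transvec_mul_diagonal_mul_list_transvec b
  set P := (L.map TransvectionStruct.toMatrix).prod with hP
  set R := (L'.map TransvectionStruct.toMatrix).prod with hR
  have hrank (w : m → K) :
      (P * diagonal w * R).rank = (Finset.univ.filter fun i ↦ w i ≠ 0).card := by
    rw [rank_mul_eq_left_of_isUnit_det _ _ (by simp [hR]),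
      rank_mul_eq_right_of_isUnit_det _ _ (by simp [hP]), rank_diagonal, Fintype.card_subtype]
  rw [hrank] at hb
  obtain ⟨s, hs, hcard⟩ := Finset.exists_superset_card_eq hb hk
  refine ⟨P * diagonal (fun i ↦ if i ∈ s ∧ d i = 0 then 1 else 0) * R, fun t ht ↦ ?_⟩
  rw [← smul_mul_assoc, ← mul_smul_comm, ← add_mul, ← mul_add, ← diagonal_smul, diagonal_add,
    hrank, ← hcard]
  congr 1
  ext i
  have hi : d i ≠ 0 → i ∈ s := fun h ↦ hs (by simpa using h)
  by_cases h : d i = 0 <;> simp_all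

theorem Matrix.rank_single_add_single_le {K m n : Type*} [Field K] [Fintype m] [Fintype n]
    [DecidableEq m] [DecidableEq n] (i i' : m) (j j' : n) (x y : K) :
    (single i j x + single i' j' y).rank ≤ 2 := by
  have h : single i j x + single i' j' y =
      (of fun p (q : Fin 2) ↦ ![Pi.single i x p, Pi.single i' y p] q) *
        of fun (q : Fin 2) r ↦ ![(Pi.single j 1 : n → K) r, (Pi.single j' 1 : n → K) r] q := by
    ext p r
    simp [mul_apply, single_apply, Pi.single_apply, Fin.sum_univ_two, ite_and, eq_comm]
    grind
  rw [h]
  exact (rank_mul_le_left _ _).trans ((rank_le_card_width _).trans (by simp))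

theorem natCast_ne_zero_of_ringChar {R : Type*} [NonAssocSemiring R] {p : ℕ} (hp : 0 < p)
    (h : ringChar R = 0 ∨ p < ringChar R) : (p : R) ≠ 0 := by
  rw [Ne, ringChar.spec]
  rintro hdvd
  rcases h with h | h
  · rw [h, zero_dvd_iff] at hdvd
    omega
  · exact absurd (Nat.le_of_dvd hp hdvd) (by omega)

/-- If the quadratic map `x ↦ [g x, x]` vanishes at `a + b`, `a - b` and `a + 2 b`, then
`6 [g b, b] = 0`. -/
theorem AddMonoidHom.six_mul_commutator_eq_zero {R : Type*} [Ring R] (g : R →+ R) (a b : R)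
    (h₁ : g (a + b) * (a + b) - (a + b) * g (a + b) = 0)
    (h₂ : g (a - b) * (a - b) - (a - b) * g (a - b) = 0)
    (h₃ : g (a + b + b) * (a + b + b) - (a + b + b) * g (a + b + b) = 0) :
    6 * (g b * b - b * g b) = 0 := by
  calc 6 * (g b * b - b * g b)
      = 2 * (g (a + b + b) * (a + b + b) - (a + b + b) * g (a + b + b))
        - 3 * (g (a + b) * (a + b) - (a + b) * g (a + b))
        + (g (a - b) * (a - b) - (a - b) * g (a - b)) := by
        simp only [map_add, map_sub]
        noncomm_ring
    _ = 0 := by rw [h₁, h₂, h₃, mul_zero, mul_zero, sub_zero, add_zero]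

/-- If `G` is additive and commutes on all rank-`k` matrices (`1 < k ≤ n - 1`),
then `G` is commuting on all of `M_n(K)`. -/
theorem stmt_4 (K : Type*) [Field K] (n : ℕ) (hn : 3 ≤ n)
    (hchar : ringChar K = 0 ∨ 3 < ringChar K)
    (k : ℕ) (hk1 : 1 < k) (hkn : k ≤ n - 1)
    (G : Matrix (Fin n) (Fin n) K → Matrix (Fin n) (Fin n) K)
    (hadd : ∀ a b, G (a + b) = G a + G b)
    (hcomm : ∀ x : Matrix (Fin n) (Fin n) K, x.rank = k → G x * x - x * G x = 0) :
    ∀ x : Matrix (Fin n) (Fin n) K, G x * x - x * G x = 0 := by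
  obtain ⟨g, rfl⟩ : ∃ g : Matrix (Fin n) (Fin n) K →+ Matrix (Fin n) (Fin n) K, ⇑g = G :=
    ⟨AddMonoidHom.mk' G hadd, rfl⟩
  have two_ne : (2 : K) ≠ 0 := by
    exact_mod_cast natCast_ne_zero_of_ringChar (R := K) two_pos (by omega)
  have three_ne : (3 : K) ≠ 0 := by
    exact_mod_cast natCast_ne_zero_of_ringChar (R := K) three_pos hchar
  have low_rank (b : Matrix (Fin n) (Fin n) K) (hb : b.rank ≤ k) : g b * b - b * g b = 0 := by
    obtain ⟨a, ha⟩ := Matrix.exists_forall_rank_add_smul_eq (by simp; omega) b hb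
    have h₁ := hcomm (a + b) (by simpa using ha 1 one_ne_zero)
    have h₂ := hcomm (a - b) (by simpa [sub_eq_add_neg] using ha (-1) (by simp))
    have h₃ := hcomm (a + b + b) (by simpa [two_smul, add_assoc] using ha 2 two_ne)
    have h := g.six_mul_commutator_eq_zero a b h₁ h₂ h₃
    have h' : ((2 : K) * 3) • (g b * b - b * g b) = 0 := by
      rw [← h, Algebra.smul_def, map_mul, map_ofNat, map_ofNat]
      norm_num
    exact (smul_eq_zero.mp h').resolve_left (mul_ne_zero two_ne three_ne)
  have polar (x y : Matrix (Fin n) (Fin n) K) :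
      g x * y - y * g x + (g y * x - x * g y) = 0 := by
    induction x using Matrix.induction_on' with
    | h_zero => simp
    | h_add p q hp hq =>
      convert congrArg₂ (· + ·) hp hq using 1
      · simp only [map_add]
        noncomm_ring
      · simp
    | h_std_basis i j c =>
      induction y using Matrix.induction_on' with
      | h_zero => simp
      | h_add p q hp hq =>
        convert congrArg₂ (· + ·) hp hq using 1
        · simp only [map_add]
          noncomm_ring
        · simp
      | h_std_basis i' j' c' =>
        have rank_one (i j : Fin n) (c : K) : (Matrix.single i j c).rank ≤ k := by
          simpa using (Matrix.rank_single_add_single_le i i j j c 0).trans hk1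
        have hx := low_rank _ (rank_one i j c)
        have hy := low_rank _ (rank_one i' j' c')
        have hxy := low_rank _ ((Matrix.rank_single_add_single_le i i' j j' c c').trans hk1)
        have h := congrArg₂ (· - ·) (congrArg₂ (· - ·) hxy hx) hy
        convert h using 1
        · simp only [map_add]
          noncomm_ring
        · simp
  intro x
  have h : (2 : K) • (g x * x - x * g x) = 0 := by rw [two_smul, polar x x]
  exact (smul_eq_zero.mp h).resolve_left two_ne
end

section
/- Let n ≥ 3 be a natural number and let K be a field with char K = 0 or char K > 3. Let M_n(K) be the ring of n × n matrices over K with center Z = K·I, where I is the identity matrix. Fix a natural number k with 1 < k ≤ n - 1. Let G : M_n(K) → M_n(K) be an additive map such that [G(x), x] = 0 for every rank-k matrix x ∈ M_n(K). Then there exist an element λ ∈ K and an additive map μ : M_n(K) → Z such that G(x) = λ·x + μ(x) for each x ∈ M_n(K). -/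
open Matrix

/-- Two linearly independent families with the same finite index type differ by an
automorphism of the ambient space. -/
theorem LinearIndependent.exists_linearEquiv_apply_eq {ι K V : Type*} [Finite ι] [Field K]
    [AddCommGroup V] [Module K V] {v v' : ι → V} (hv : LinearIndependent K v)
    (hv' : LinearIndependent K v') : ∃ g : V ≃ₗ[K] V, ∀ i, g (v i) = v' i := by
  have : FiniteDimensional K (Submodule.span K (Set.range v)) :=
    FiniteDimensional.span_of_finite K (Set.finite_range v)
  obtain ⟨g, hg⟩ := Submodule.exists_linearEquiv_restrict_eq
    (hv.linearCombinationEquiv.symm.trans hv'.linearCombinationEquiv)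
  refine ⟨g, fun i => ?_⟩
  have h := hg ⟨v i, Submodule.subset_span ⟨i, rfl⟩⟩
  have hs : hv.linearCombinationEquiv.symm ⟨v i, Submodule.subset_span ⟨i, rfl⟩⟩ =
      Finsupp.single i 1 := by
    rw [LinearEquiv.symm_apply_eq]
    ext
    simp
  rw [← h, LinearEquiv.trans_apply, hs]
  simp

/-- A property of vectors that is stable under subtraction and holds off a line holds
everywhere. -/
theorem forall_of_forall_linearIndependent_pair {K V : Type*} [Field K] [AddCommGroup V]
    [Module K V] (hV : 1 < Module.finrank K V) {u : V} (hu : u ≠ 0) {p : V → Prop}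
    (hsub : ∀ a b, p a → p b → p (a - b))
    (h : ∀ w, LinearIndependent K ![u, w] → p w) (w : V) : p w := by
  by_cases hw : LinearIndependent K ![u, w]
  · exact h w hw
  rw [LinearIndependent.pair_iff' hu] at hw
  push Not at hw
  obtain ⟨a, rfl⟩ := hw
  obtain ⟨y, hy⟩ := exists_linearIndependent_pair_of_one_lt_finrank hV hu
  have hy' : LinearIndependent K ![u, a • u + y] := by
    rw [LinearIndependent.pair_iff' hu] at hy ⊢
    intro b hb
    exact hy (b - a) (by rw [sub_smul, hb, add_sub_cancel_left])
  simpa using hsub _ _ (h _ hy') (h _ hy)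

namespace Matrix

variable {m K : Type*} [Fintype m] [DecidableEq m] [Field K]

/-- There is an invertible matrix with two prescribed, linearly independent, columns. -/
theorem exists_isUnit_det_mulVec_single_eq {i j : m} (hij : i ≠ j) {u w : m → K}
    (h : LinearIndependent K ![u, w]) :
    ∃ P : Matrix m m K, IsUnit P.det ∧ P *ᵥ Pi.single i 1 = u ∧ P *ᵥ Pi.single j 1 = w := by
  have hs : LinearIndependent K ![(Pi.single i 1 : m → K), Pi.single j 1] := by
    rw [LinearIndependent.pair_iff]
    intro s t hst
    have h1 := congrFun hst i
    have h2 := congrFun hst j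
    simp [hij, hij.symm] at h1 h2
    exact ⟨h1, h2⟩
  obtain ⟨g, hg⟩ := hs.exists_linearEquiv_apply_eq h
  refine ⟨LinearMap.toMatrix' g.toLinearMap, ?_, ?_, ?_⟩
  · rw [LinearMap.det_toMatrix']
    exact LinearEquiv.isUnit_det' g
  · rw [LinearMap.toMatrix'_mulVec]
    exact hg 0
  · rw [LinearMap.toMatrix'_mulVec]
    exact hg 1

/-- Two rank-one matrices in general position can be completed by a common summand to matrices of
rank `k`, no matter how they are scaled. -/
theorem exists_forall_rank_add_eq {k : ℕ} (hk : 1 < k) (hkm : k ≤ Fintype.card m)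
    {u w v z : m → K} (huw : LinearIndependent K ![u, w]) (hvz : LinearIndependent K ![v, z]) :
    ∃ R : Matrix m m K, ∀ s t : K, s ≠ 0 → t ≠ 0 →
      (s • vecMulVec u v + t • vecMulVec w z + R).rank = k := by
  classical
  obtain ⟨S, hS⟩ := Finset.exists_subset_card_eq (s := (Finset.univ : Finset m)) hkm
  obtain ⟨-, hS⟩ := hS
  obtain ⟨i, hi, j, hj, hij⟩ := Finset.one_lt_card.1 (hS ▸ hk)
  obtain ⟨P, hP, rfl, rfl⟩ := exists_isUnit_det_mulVec_single_eq hij huw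
  obtain ⟨Q, hQ, rfl, rfl⟩ := exists_isUnit_det_mulVec_single_eq hij hvz
  refine ⟨P * diagonal (fun l => if l ∈ (S.erase i).erase j then 1 else 0) * Qᵀ,
    fun s t hs ht => ?_⟩
  have key : s • vecMulVec (P *ᵥ Pi.single i 1) (Q *ᵥ Pi.single i 1) +
      t • vecMulVec (P *ᵥ Pi.single j 1) (Q *ᵥ Pi.single j 1) +
      P * diagonal (fun l => if l ∈ (S.erase i).erase j then (1 : K) else 0) * Qᵀ =
      P * diagonal (fun l => if l = i then s else if l = j then t else if l ∈ S then 1 else 0)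
        * Qᵀ := by
    have hd : diagonal (fun l => if l = i then s else if l = j then t else
          if l ∈ S then (1 : K) else 0) =
        s • vecMulVec (Pi.single i 1) (Pi.single i 1) +
        t • vecMulVec (Pi.single j 1) (Pi.single j 1) +
        diagonal (fun l => if l ∈ (S.erase i).erase j then (1 : K) else 0) := by
      rw [← single_eq_single_vecMulVec_single, ← single_eq_single_vecMulVec_single]
      ext a b
      by_cases hab : a = b
      · subst hab
        by_cases hai : a = i
        · subst hai
          simp [hij.symm]
        · by_cases haj : a = j
          · subst haj
            simp [hij, hij.symm]
          · simp [hai, haj, Ne.symm hai, Ne.symm haj]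
      · have h1 (c : m) : ¬ (c = a ∧ c = b) := fun h => hab (h.1.symm.trans h.2)
        simp [hab, h1]
    rw [hd, mul_add, mul_add, add_mul, add_mul, mul_smul_comm, mul_smul_comm, smul_mul_assoc,
      smul_mul_assoc, mul_vecMulVec, mul_vecMulVec, vecMulVec_mul, vecMulVec_mul,
      vecMul_transpose, vecMul_transpose]
  rw [key, rank_mul_eq_left_of_isUnit_det _ _ (by rwa [det_transpose]),
    rank_mul_eq_right_of_isUnit_det _ _ hP, rank_diagonal, Fintype.card_subtype, ← hS]
  congr 1
  ext l
  by_cases hli : l = i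
  · simp [hli, hs, hi]
  · by_cases hlj : l = j
    · subst hlj
      simp [hli, ht, hj]
    · simp [hli, hlj]

/-- A biadditive map on matrices which vanishes on pairs of rank-one matrices in general
position vanishes identically. -/
theorem eq_zero_of_forall_vecMulVec {A : Type*} [AddCommGroup A] (hm : 1 < Fintype.card m)
    (B : Matrix m m K →+ Matrix m m K →+ A)
    (hB : ∀ u w v z : m → K, LinearIndependent K ![u, w] → LinearIndependent K ![v, z] →
      B (vecMulVec u v) (vecMulVec w z) = 0) : B = 0 := by
  have hV : 1 < Module.finrank K (m → K) := by simpa using hm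
  have h1 (u w v z : m → K) (hvz : LinearIndependent K ![v, z]) :
      B (vecMulVec u v) (vecMulVec w z) = 0 := by
    by_cases hu : u = 0
    · simp [hu]
    refine forall_of_forall_linearIndependent_pair hV hu
      (p := fun w => B (vecMulVec u v) (vecMulVec w z) = 0) ?_ (fun w hw => hB u w v z hw hvz) w
    intro a b ha hb
    rw [sub_vecMulVec, map_sub, ha, hb, sub_zero]
  have h2 (u w v z : m → K) : B (vecMulVec u v) (vecMulVec w z) = 0 := by
    by_cases hv : v = 0
    · simp [hv]
    refine forall_of_forall_linearIndependent_pair hV hv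
      (p := fun z => B (vecMulVec u v) (vecMulVec w z) = 0) ?_ (fun z hz => h1 u w v z hz) z
    intro a b ha hb
    rw [vecMulVec_sub, map_sub, ha, hb, sub_zero]
  have hsingle (i j : m) (x : K) :
      single i j x = vecMulVec (x • Pi.single i 1) (Pi.single j 1) := by
    rw [smul_vecMulVec, ← single_eq_single_vecMulVec_single, smul_single, smul_eq_mul, mul_one]
  ext a b
  induction a using Matrix.induction_on' with
  | h_zero => simp
  | h_add p q hp hq => simp [hp, hq]
  | h_std_basis i j x =>
    induction b using Matrix.induction_on' with
    | h_zero => simp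
    | h_add p q hp hq => simp [hp, hq]
    | h_std_basis i' j' y =>
      rw [hsingle, hsingle]
      exact h2 _ _ _ _

/-- An additive map commuting on all matrices of a fixed rank `k > 1` is commuting. -/
theorem commute_of_forall_rank_eq_commute (h2 : (2 : K) ≠ 0) {k : ℕ} (hk : 1 < k)
    (hkm : k ≤ Fintype.card m) (G : Matrix m m K →+ Matrix m m K)
    (hG : ∀ x : Matrix m m K, x.rank = k → Commute (G x) x) (x : Matrix m m K) :
    Commute (G x) x := by
  let C : Matrix m m K →+ Matrix m m K →+ Matrix m m K :=
    AddMonoidHom.mul.comp G - AddMonoidHom.mul.flip.comp G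
  let B := C + C.flip
  have hBapp (a b : Matrix m m K) : B a b = G a * b - b * G a + (G b * a - a * G b) := rfl
  have half {a : Matrix m m K} (ha : (2 : K) • a = 0) : a = 0 :=
    (smul_eq_zero.1 ha).resolve_left h2
  have hB : B = 0 := by
    refine eq_zero_of_forall_vecMulVec (hk.trans_le hkm) B fun u w v z huw hvz => ?_
    obtain ⟨R, hR⟩ := exists_forall_rank_add_eq hk hkm huw hvz
    have e (s t : K) (hs : s ≠ 0) (ht : t ≠ 0) := sub_eq_zero.2 (hG _ (hR s t hs ht)).eq
    have n1 : (-1 : K) ≠ 0 := neg_ne_zero.2 one_ne_zero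
    have e1 := e 1 1 one_ne_zero one_ne_zero
    have e2 := e 1 (-1) one_ne_zero n1
    have e3 := e (-1) 1 n1 one_ne_zero
    have e4 := e (-1) (-1) n1 n1
    simp only [one_smul, neg_smul, map_add, map_neg] at e1 e2 e3 e4
    apply half
    apply half
    rw [hBapp, two_smul, two_smul]
    linear_combination (norm := noncomm_ring) e1 - e2 - e3 + e4
  have hx := hBapp x x
  rw [hB] at hx
  refine sub_eq_zero.1 (half ?_)
  rw [two_smul]
  exact hx.symm

/-- An additive commuting map on a matrix ring is a scalar multiple of the identity up to
scalar matrices. -/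
theorem exists_forall_sub_smul_mem_range_scalar (hm : 1 < Fintype.card m)
    (G : Matrix m m K →+ Matrix m m K) (hG : ∀ x, Commute (G x) x) :
    ∃ c : K, ∀ x, G x - c • x ∈ Set.range (scalar m) := by
  have hlin (x y : Matrix m m K) : G x * y - y * G x = x * G y - G y * x := by
    have h1 := (hG x).eq
    have h2 := (hG y).eq
    have h3 := (hG (x + y)).eq
    rw [map_add] at h3
    rw [sub_eq_sub_iff_add_eq_add]
    have h4 : (G x + G y) * (x + y) - G x * x - G y * y =
        (x + y) * (G x + G y) - x * G x - y * G y := by rw [h3, h1, h2]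
    calc G x * y + G y * x = (G x + G y) * (x + y) - G x * x - G y * y := by noncomm_ring
      _ = x * G y + y * G x := by rw [h4]; noncomm_ring
  have hswap (x y u v : Matrix m m K) : (G x * y - y * G x) * (u * v - v * u) =
      (x * y - y * x) * (G u * v - v * G u) := by
    have e1 := hlin (x * u) (y * v)
    have a1 : G (x * u) * (y * v) - (y * v) * G (x * u) =
        (G (x * u) * y - y * G (x * u)) * v + y * (G (x * u) * v - v * G (x * u)) := by
      noncomm_ring
    have a2 : (x * u) * G (y * v) - G (y * v) * (x * u) =
        (x * G (y * v) - G (y * v) * x) * u + x * (u * G (y * v) - G (y * v) * u) := by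
      noncomm_ring
    rw [a1, a2, hlin (x * u) y, hlin (x * u) v, ← hlin x (y * v), ← hlin u (y * v)] at e1
    have b1 := hlin x y
    have b2 := hlin x v
    have b3 := hlin u y
    have c1 : (x * u * G y - G y * (x * u)) =
        x * (G u * y - y * G u) + (G x * y - y * G x) * u := by
      rw [b1, b3]; noncomm_ring
    have c2 : (x * u * G v - G v * (x * u)) =
        x * (G u * v - v * G u) + (G x * v - v * G x) * u := by
      rw [b2, hlin u v]; noncomm_ring
    rw [c1, c2] at e1
    rw [← sub_eq_zero] at e1 ⊢
    rw [← e1]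
    noncomm_ring
  have hswap' (x y z u v : Matrix m m K) : (G x * y - y * G x) * z * (u * v - v * u) =
      (x * y - y * x) * z * (G u * v - v * G u) := by
    have e1 := hswap x y (z * u) v
    have e2 := hswap x y z v
    have c2 : G (z * u) * v - v * G (z * u) =
        z * (G u * v - v * G u) + (G z * v - v * G z) * u := by
      rw [hlin (z * u) v, hlin u v, hlin z v]; noncomm_ring
    rw [c2] at e1
    have e3 : (G x * y - y * G x) * z * (u * v - v * u) =
      (G x * y - y * G x) * (z * u * v - v * (z * u))
        - (G x * y - y * G x) * (z * v - v * z) * u := by noncomm_ring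
    rw [e3, e1, e2]
    noncomm_ring
  obtain ⟨i, j, hij⟩ := Fintype.one_lt_card_iff.1 hm
  set W : Matrix m m K := G (single i j 1) * single j j 1 - single j j 1 * G (single i j 1)
    with hWdef
  have hbr : (single i j 1 * single j j 1 - single j j 1 * single i j 1 : Matrix m m K) =
      single i j 1 := by
    simp [hij.symm]
  have hWz (z : Matrix m m K) : W * z * single i j 1 = single i j 1 * z * W := by
    have h := hswap' (single i j 1) (single j j 1) z (single i j 1) (single j j 1)
    rwa [hbr] at h
  have hW : W = W i j • single i j 1 := by
    ext a b
    have h1 := congrFun (congrFun (hWz (single j a 1)) i) b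
    by_cases ha : a = i
    · subst ha
      by_cases hb : b = j
      · subst hb
        simp
      · simp [hb, Ne.symm hb] at h1 ⊢
        exact h1.symm
    · simp [mul_assoc, ha, Ne.symm ha] at h1 ⊢
      exact h1.symm
  refine ⟨W i j, fun x => mem_range_scalar_iff_commute_single'.2 fun p q => ?_⟩
  set y : Matrix m m K := single p q 1
  have hD : ((G x - W i j • x) * y - y * (G x - W i j • x)) = 0 := by
    have hz (z : Matrix m m K) :
        ((G x - W i j • x) * y - y * (G x - W i j • x)) * z * single i j 1 = 0 := by
      have h := hswap' x y z (single i j 1) (single j j 1)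
      rw [← hWdef, hbr, hW, mul_smul_comm] at h
      have e : ((G x - W i j • x) * y - y * (G x - W i j • x)) =
          (G x * y - y * G x) - W i j • (x * y - y * x) := by
        rw [sub_mul, mul_sub, smul_sub, smul_mul_assoc, mul_smul_comm]
        abel
      rw [e, sub_mul, sub_mul, h, smul_mul_assoc, smul_mul_assoc, sub_self]
    ext a b
    have := congrFun (congrFun (hz (single b i 1)) a) j
    simpa [mul_assoc] using this
  exact (sub_eq_zero.1 hD).symm

end Matrix

/-- If `G` is additive and commutes on all rank-`k` matrices (`1 < k ≤ n - 1`),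
then `G x = λ • x + μ x • I` for some `λ ∈ K` and an additive map `μ` into the center. -/
theorem stmt_5 (K : Type*) [Field K] (n : ℕ) (hn : 3 ≤ n)
    (hchar : ringChar K = 0 ∨ 3 < ringChar K)
    (k : ℕ) (hk1 : 1 < k) (hkn : k ≤ n - 1)
    (G : Matrix (Fin n) (Fin n) K → Matrix (Fin n) (Fin n) K)
    (hadd : ∀ a b, G (a + b) = G a + G b)
    (hcomm : ∀ x : Matrix (Fin n) (Fin n) K, x.rank = k → G x * x - x * G x = 0) :
    ∃ (lam : K) (μ : Matrix (Fin n) (Fin n) K → K),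
      (∀ a b, μ (a + b) = μ a + μ b) ∧
      ∀ x, G x = lam • x + μ x • (1 : Matrix (Fin n) (Fin n) K) := by
  have h2 : (2 : K) ≠ 0 := by
    apply Ring.two_ne_zero
    omega
  let G' : Matrix (Fin n) (Fin n) K →+ Matrix (Fin n) (Fin n) K := AddMonoidHom.mk' G hadd
  have hG := commute_of_forall_rank_eq_commute h2 hk1 (by simp; omega) G'
    fun x hx => sub_eq_zero.1 (hcomm x hx)
  obtain ⟨c, hc⟩ := exists_forall_sub_smul_mem_range_scalar (by simp; omega) G' hG
  choose μ hμ using hc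
  have hμ' (x : Matrix (Fin n) (Fin n) K) : G x = c • x + μ x • 1 := by
    rw [smul_one_eq_diagonal, ← scalar_apply, hμ]
    exact (add_sub_cancel _ _).symm
  have : Nonempty (Fin n) := ⟨⟨0, by omega⟩⟩
  refine ⟨c, μ, fun a b => scalar_inj (n := Fin n) |>.1 ?_, hμ'⟩
  rw [map_add, hμ, hμ, hμ, map_add, smul_add]
  abel
end

section
/- Let K be a field and let M_2(K) be the ring of 2 × 2 matrices over K with center Z = K·I, where I is the identity matrix. Let G : M_2(K) → M_2(K) be an additive map such that [G(x), x] = 0 for every rank-1 matrix x ∈ M_2(K). Then there exist an element λ ∈ K and an additive map μ : M_2(K) → Z such that G(x) = λ·x + μ(x) for each x ∈ M_2(K). -/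
open Matrix in
/-- A map that commutes on rank-1 matrices also commutes on all outer products. -/
theorem commute_vecMulVec_of_rank_one {n K : Type*} [Fintype n] [Field K]
    (G : Matrix n n K → Matrix n n K)
    (hcomm : ∀ x : Matrix n n K, x.rank = 1 → G x * x - x * G x = 0) (v w : n → K) :
    G (vecMulVec v w) * vecMulVec v w = vecMulVec v w * G (vecMulVec v w) := by
  rcases Nat.le_one_iff_eq_zero_or_eq_one.mp (rank_vecMulVec_le v w) with h | h
  · have h_zero : vecMulVec v w = 0 := by
      rw [rank, Submodule.finrank_eq_zero, LinearMap.range_eq_bot] at h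
      exact ext_iff_mulVec.mpr fun u => by simpa using LinearMap.congr_fun h u
    rw [h_zero, mul_zero, zero_mul]
  · exact sub_eq_zero.mp (hcomm _ h)

/-- The entrywise form of the commutation of two `2 × 2` matrices. -/
theorem Matrix.entries_of_mul_comm_fin_two {K : Type*} [Field K] {x y : Matrix (Fin 2) (Fin 2) K}
    (h : y * x = x * y) :
    y 0 1 * x 1 0 = y 1 0 * x 0 1 ∧
      (y 0 0 - y 1 1) * x 0 1 = y 0 1 * (x 0 0 - x 1 1) ∧
      (y 0 0 - y 1 1) * x 1 0 = y 1 0 * (x 0 0 - x 1 1) := by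
  have h₀₀ := congrFun (congrFun h 0) 0
  have h₀₁ := congrFun (congrFun h 0) 1
  have h₁₀ := congrFun (congrFun h 1) 0
  simp only [Matrix.mul_apply, Fin.sum_univ_two] at h₀₀ h₀₁ h₁₀
  refine ⟨?_, ?_, ?_⟩
  · linear_combination h₀₀
  · linear_combination h₀₁
  · linear_combination -h₁₀


/-- If `G : M_2(K) → M_2(K)` is additive and commutes on all rank-1 matrices,
then `G x = λ • x + μ x • I` for some `λ ∈ K` and an additive map `μ` into the center. -/
theorem stmt_6 (K : Type*) [Field K]
    (G : Matrix (Fin 2) (Fin 2) K → Matrix (Fin 2) (Fin 2) K)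
    (hadd : ∀ a b, G (a + b) = G a + G b)
    (hcomm : ∀ x : Matrix (Fin 2) (Fin 2) K, x.rank = 1 → G x * x - x * G x = 0) :
    ∃ (lam : K) (μ : Matrix (Fin 2) (Fin 2) K → K),
      (∀ a b, μ (a + b) = μ a + μ b) ∧
      ∀ x, G x = lam • x + μ x • (1 : Matrix (Fin 2) (Fin 2) K) := by
  have hc (a b c d : K) := Matrix.entries_of_mul_comm_fin_two
    (x := !![a * c, a * d; b * c, b * d]) (y := G !![a * c, a * d; b * c, b * d]) (by
      have h : !![a * c, a * d; b * c, b * d] = Matrix.vecMulVec ![a, b] ![c, d] := by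
        ext i j
        fin_cases i <;> fin_cases j <;> simp [Matrix.vecMulVec_apply]
      rw [h]
      exact commute_vecMulVec_of_rank_one G hcomm _ _)
  have h_zero : G 0 = 0 := by simpa using hadd 0 0
  have h_zero' : G !![0, 0; 0, 0] = 0 := by
    rw [← h_zero]
    congr 1
    ext i j
    fin_cases i <;> fin_cases j <;> rfl
  have h₁₁ (t : K) : G !![t, 0; 0, 0] 0 1 = 0 ∧ G !![t, 0; 0, 0] 1 0 = 0 := by
    rcases eq_or_ne t 0 with rfl | ht
    · simp [h_zero']
    · simpa [ht] using hc 1 0 t 0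
  have h₁₂ (t : K) : G !![0, t; 0, 0] 1 0 = 0 ∧
      G !![0, t; 0, 0] 0 0 - G !![0, t; 0, 0] 1 1 = 0 := by
    rcases eq_or_ne t 0 with rfl | ht
    · simp [h_zero']
    · simpa [ht] using hc 1 0 0 t
  have h₂₁ (t : K) : G !![0, 0; t, 0] 0 1 = 0 ∧
      G !![0, 0; t, 0] 0 0 - G !![0, 0; t, 0] 1 1 = 0 := by
    rcases eq_or_ne t 0 with rfl | ht
    · simp [h_zero']
    · simpa [ht] using hc 0 1 t 0
  have h₂₂ (t : K) : G !![0, 0; 0, t] 0 1 = 0 ∧ G !![0, 0; 0, t] 1 0 = 0 := by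
    rcases eq_or_ne t 0 with rfl | ht
    · simp [h_zero']
    · simpa [ht] using hc 0 1 0 t
  have h_row (t u : K) : (G !![t, 0; 0, 0] 0 0 - G !![t, 0; 0, 0] 1 1) * u =
      G !![0, u; 0, 0] 0 1 * t := by
    have h := (hc 1 0 t u).2.1
    have hG : G !![t, u; 0, 0] = G !![t, 0; 0, 0] + G !![0, u; 0, 0] := by
      rw [← hadd]
      simp
    simp [hG] at h
    linear_combination h - u * (h₁₂ u).2 + t * (h₁₁ t).1
  have h_col (t u : K) : (G !![t, 0; 0, 0] 0 0 - G !![t, 0; 0, 0] 1 1) * u =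
      G !![0, 0; u, 0] 1 0 * t := by
    have h := (hc t u 1 0).2.2
    have hG : G !![t, 0; u, 0] = G !![t, 0; 0, 0] + G !![0, 0; u, 0] := by
      rw [← hadd]
      simp
    simp [hG] at h
    linear_combination h - u * (h₂₁ u).2 + t * (h₁₁ t).2
  have h_col' (t u : K) : (G !![0, 0; 0, t] 0 0 - G !![0, 0; 0, t] 1 1) * u =
      -(G !![0, u; 0, 0] 0 1 * t) := by
    have h := (hc u t 0 1).2.1
    have hG : G !![0, u; 0, t] = G !![0, 0; 0, t] + G !![0, u; 0, 0] := by
      rw [← hadd]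
      simp
    simp [hG] at h
    linear_combination h - u * (h₁₂ u).2 - t * (h₂₂ t).1
  obtain ⟨lam, h_lam⟩ : ∃ lam, lam = G !![1, 0; 0, 0] 0 0 - G !![1, 0; 0, 0] 1 1 := ⟨_, rfl⟩
  refine ⟨lam, fun x => G x 1 1 - lam * x 1 1, fun a b => ?_, fun x => ?_⟩
  · simp only [hadd, Matrix.add_apply]
    ring
  · have h_sum : G x = G !![x 0 0, 0; 0, 0] + G !![0, x 0 1; 0, 0] +
        G !![0, 0; x 1 0, 0] + G !![0, 0; 0, x 1 1] := by
      rw [← hadd, ← hadd, ← hadd]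
      congr 1
      ext i j
      fin_cases i <;> fin_cases j <;> simp
    have h_one := h_row 1 1
    have h₀₁ : G x 0 1 = lam * x 0 1 := by
      rw [h_sum]
      simp only [Matrix.add_apply]
      linear_combination (h₁₁ (x 0 0)).1 + (h₂₁ (x 1 0)).1 + (h₂₂ (x 1 1)).1 -
        h_row 1 (x 0 1) - x 0 1 * h_lam
    have h₁₀ : G x 1 0 = lam * x 1 0 := by
      rw [h_sum]
      simp only [Matrix.add_apply]
      linear_combination (h₁₁ (x 0 0)).2 + (h₁₂ (x 0 1)).1 + (h₂₂ (x 1 1)).2 -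
        h_col 1 (x 1 0) - x 1 0 * h_lam
    have h_diag : G x 0 0 - G x 1 1 = lam * (x 0 0 - x 1 1) := by
      rw [h_sum]
      simp only [Matrix.add_apply]
      linear_combination h_row (x 0 0) 1 + (h₁₂ (x 0 1)).2 + (h₂₁ (x 1 0)).2 +
        h_col' (x 1 1) 1 - (x 0 0 - x 1 1) * (h_one + h_lam)
    ext i j
    fin_cases i <;> fin_cases j <;> simp [h₀₁, h₁₀]
    linear_combination h_diag
end

section
/- Let K be any field and fix a natural number n ≥ 3. Then there exists a K-linear (hence additive) map G : M_n(K) → M_n(K) such that [G(x), x] = 0 for every rank-1 matrix x ∈ M_n(K), but there exist no element λ ∈ K and no additive map μ : M_n(K) → Z with G(x) = λ·x + μ(x) for all x ∈ M_n(K), where Z = K·I is the center of M_n(K). -/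
/-- The alternating matrix `E i j - E j i`. -/
def altUnit {ι : Type*} (R : Type*) [DecidableEq ι] [Ring R] (i j : ι) : Matrix ι ι R :=
  Matrix.single i j 1 - Matrix.single j i 1

/-- A matrix of rank one is an outer product. -/
theorem exists_eq_vecMulVec_of_rank_eq_one {m n K : Type*} [Finite m] [Fintype n] [Field K]
    {x : Matrix m n K} (hx : x.rank = 1) : ∃ u v, x = Matrix.vecMulVec u v := by
  classical
  obtain ⟨u, -, hu⟩ := finrank_eq_one_iff'.mp hx
  choose c hc using fun j => hu ⟨x.mulVecLin (Pi.single j 1), LinearMap.mem_range_self _ _⟩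
  refine ⟨u, c, ?_⟩
  ext i j
  have h := congrFun (congrArg Subtype.val (hc j)) i
  simp only [Submodule.coe_smul, Pi.smul_apply, smul_eq_mul, Matrix.mulVecLin_apply,
    Matrix.mulVec_single_one, Matrix.col_apply] at h
  rw [Matrix.vecMulVec_apply, ← h, mul_comm]

theorem transpose_mul_altUnit_mul_eq_zero {ι K : Type*} [Fintype ι] [DecidableEq ι] [Field K]
    {x : Matrix ι ι K} (hx : x.rank = 1) (i j : ι) :
    x.transpose * altUnit K i j * x = 0 := by
  obtain ⟨u, v, rfl⟩ := exists_eq_vecMulVec_of_rank_eq_one hx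
  have h : Matrix.vecMul u (altUnit K i j) ⬝ᵥ u = 0 := by
    simp [altUnit, Matrix.sub_mulVec, ← Matrix.dotProduct_mulVec, dotProduct_sub, Matrix.single_mulVec_eq,
      mul_comm]
  rw [Matrix.transpose_vecMulVec, Matrix.vecMulVec_mul, Matrix.vecMulVec_mul_vecMulVec, h]
  simp

/-- For any field `K` and `n ≥ 3`, there is a `K`-linear (hence additive)
map `G : M_n(K) → M_n(K)` commuting on all rank-1 matrices which is not of the form
`x ↦ λ • x + μ x • I` with `μ` additive into the center `Z = K • I`. -/
theorem stmt_8 (K : Type*) [Field K] (n : ℕ) (hn : 3 ≤ n) :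
    ∃ G : Matrix (Fin n) (Fin n) K → Matrix (Fin n) (Fin n) K,
      (∀ a b, G (a + b) = G a + G b) ∧
      (∀ (c : K) a, G (c • a) = c • G a) ∧
      (∀ x : Matrix (Fin n) (Fin n) K, x.rank = 1 → G x * x - x * G x = 0) ∧
      ¬ ∃ (lam : K) (μ : Matrix (Fin n) (Fin n) K → K),
          (∀ a b, μ (a + b) = μ a + μ b) ∧
          ∀ x, G x = lam • x + μ x • (1 : Matrix (Fin n) (Fin n) K) := by
  obtain ⟨i, j, k, hij, hik, hjk⟩ : ∃ i j k : Fin n, i ≠ j ∧ i ≠ k ∧ j ≠ k :=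
    ⟨⟨0, by omega⟩, ⟨1, by omega⟩, ⟨2, by omega⟩, by simp, by simp, by simp⟩
  refine ⟨fun x => altUnit K i j * x.transpose * altUnit K i j, fun a b => ?_, fun c a => ?_,
    fun x hx => ?_, ?_⟩
  · simp [mul_add, add_mul]
  · simp
  · have h₁ := transpose_mul_altUnit_mul_eq_zero hx i j
    have h₂ := transpose_mul_altUnit_mul_eq_zero
      (x := x.transpose) (by rwa [Matrix.rank_transpose]) i j
    rw [Matrix.transpose_transpose] at h₂
    simp only [← mul_assoc] at h₁ h₂ ⊢
    rw [h₂, mul_assoc, mul_assoc, ← mul_assoc x.transpose, h₁]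
    simp
  · rintro ⟨lam, μ, -, h⟩
    have hk := h (Matrix.single k k 1)
    have hμ : μ (Matrix.single k k 1) = 0 := by
      simpa [altUnit, mul_sub, sub_mul, hij, hik, hjk, hij.symm, hik.symm, hjk.symm]
        using (congrFun (congrFun hk i) i).symm
    have hlam : lam = 0 := by
      simpa [altUnit, mul_sub, sub_mul, hij, hik, hjk, hij.symm, hik.symm, hjk.symm, hμ]
        using (congrFun (congrFun hk k) k).symm
    have h' := congrFun (congrFun (h (Matrix.single i j 1)) i) j
    simp [altUnit, sub_mul, hij, hij.symm, hlam] at h'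
end

section
/- Let K be a field and let m, n be natural numbers with n ≥ m + 1 and m > 1. Assume char K = 0 or char K > m + 1, and that K contains at least m + 4 elements. Fix a natural number k with m + 1 ≤ k ≤ n. Let G : M_n(K)^m → M_n(K) be a symmetric m-additive map such that [G(x, …, x), x] = 0 for every rank-k matrix x ∈ M_n(K). Then [G(x, …, x), x] = 0 for every matrix x ∈ M_n(K). -/
open Matrix Polynomial

/-- A matrix `x` of rank less than `k` lies on a line `x + t • y` all of whose other points,
including the point `y` at infinity, have rank `k`. -/
theorem Matrix.exists_rank_eq_and_rank_add_smul_eq {ι K : Type*} [Fintype ι] [DecidableEq ι]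
    [Field K] {k : ℕ} (hk : k ≤ Fintype.card ι) (x : Matrix ι ι K) (hx : x.rank < k) :
    ∃ y : Matrix ι ι K, y.rank = k ∧ ∀ t : K, t ≠ 0 → (x + t • y).rank = k := by
  classical
  obtain ⟨L, L', D, rfl⟩ := Pivot.exists_list_transvec_mul_diagonal_mul_list_transvec x
  have hL : IsUnit (L.map TransvectionStruct.toMatrix).prod.det := by simp
  have hL' : IsUnit (L'.map TransvectionStruct.toMatrix).prod.det := by simp
  set U := (L.map TransvectionStruct.toMatrix).prod
  set V := (L'.map TransvectionStruct.toMatrix).prod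
  rw [rank_mul_eq_left_of_isUnit_det _ _ hL', rank_mul_eq_right_of_isUnit_det _ _ hL,
    rank_diagonal, Fintype.card_subtype] at hx
  obtain ⟨B, hAB, -, hB⟩ := Finset.exists_subsuperset_card_eq
    (Finset.subset_univ {i | D i ≠ 0}) hx.le hk
  obtain ⟨b, hb⟩ : ∃ b, D b = 0 := by
    by_contra! h
    simp [h] at hx
    omega
  obtain ⟨σ, hσ, -⟩ := Finset.exists_cycleOn (Finset.univ : Finset ι)
  let E : Matrix ι ι K := diagonal fun i => if i ∈ B then 1 else 0
  have hE : E.rank = k := by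
    rw [rank_diagonal, Fintype.card_subtype, ← hB]
    congr 1
    ext i
    simp
  have hED : E * diagonal D = diagonal D := by
    rw [diagonal_mul_diagonal]
    congr 1
    ext i
    by_cases hi : D i = 0
    · simp [hi]
    · simp [hAB (by simpa using hi : i ∈ ({i | D i ≠ 0} : Finset ι))]
  let P : Matrix ι ι K := σ.permMatrix K
  have hP : IsUnit P.det := by
    rw [det_permutation]
    exact (Units.isUnit _).map (Int.castRingHom K)
  have hPinv : IsUnit P⁻¹.det := isUnit_nonsing_inv_det _ hP
  refine ⟨U * (E * P⁻¹) * V, ?_, fun t ht => ?_⟩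
  · rw [rank_mul_eq_left_of_isUnit_det _ _ hL', rank_mul_eq_right_of_isUnit_det _ _ hL,
      rank_mul_eq_left_of_isUnit_det _ _ hPinv, hE]
  have hfac : U * diagonal D * V + t • (U * (E * P⁻¹) * V) =
      U * (E * (P⁻¹ * (P * diagonal D + t • 1))) * V := by
    rw [mul_add, ← mul_assoc P⁻¹, nonsing_inv_mul _ hP, one_mul, mul_add, hED]
    simp [mul_add, add_mul, mul_assoc]
  have hunit : IsUnit (P * diagonal D + t • 1).det := by
    rw [← isUnit_iff_isUnit_det, ← mulVec_injective_iff_isUnit]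
    refine (injective_iff_map_eq_zero (mulVecLin (P * diagonal D + t • 1))).2 fun v hv => ?_
    have key (i : ι) : D (σ i) * v (σ i) + t * v i = 0 := by
      have := congrFun hv i
      simpa [P, Equiv.Perm.permMatrix, add_mulVec, ← mulVec_mulVec, smul_mulVec,
        PEquiv.toMatrix_toPEquiv_mulVec, mulVec_diagonal] using this
    have hstep (i : ι) (h : D (σ i) * v (σ i) = 0) : v i = 0 := by
      simpa [h, ht] using key i
    have hpow (N : ℕ) : ∀ i, v ((σ ^ N) i) = 0 → v i = 0 := by
      induction N with
      | zero => simp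
      | succ N ih =>
        intro i h
        exact hstep i (by rw [ih (σ i) (by simpa [pow_succ] using h), mul_zero])
    ext i
    obtain ⟨N, -, hN⟩ := hσ.exists_pow_eq (Finset.mem_univ i) (Finset.mem_univ (σ.symm b))
    exact hpow N i (by rw [hN]; exact hstep _ (by simp [hb]))
  rw [hfac, rank_mul_eq_left_of_isUnit_det _ _ hL', rank_mul_eq_right_of_isUnit_det _ _ hL,
    ← mul_assoc, rank_mul_eq_left_of_isUnit_det _ _ hunit,
    rank_mul_eq_left_of_isUnit_det _ _ hPinv, hE]

/-- A `d`-additive map whose diagonal vanishes at `y` and at `x + j • y` for `j = 1, …, d` also has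
vanishing diagonal at `x`, provided `1, …, d` are distinct in the target field. -/
theorem MultilinearMap.diag_eq_zero_of_diag_add_nsmul_eq_zero {M K : Type*} [AddCommMonoid M]
    [Field K] {d : ℕ} (f : MultilinearMap ℕ (fun _ : Fin d => M) K) (hd : 0 < d)
    (hinj : Function.Injective fun j : Fin d => ((j + 1 : ℕ) : K)) (x y : M)
    (hy : f (fun _ => y) = 0) (hxy : ∀ j : Fin d, f (fun _ => x + (j + 1 : ℕ) • y) = 0) :
    f (fun _ => x) = 0 := by
  let p : K[X] := ∑ s : Finset (Fin d), C (f (s.piecewise (fun _ => y) fun _ => x)) * X ^ s.card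
  have heval (j : ℕ) : p.eval (j : K) = f fun _ => x + j • y := by
    have h : (fun _ : Fin d => x + j • y) = (fun _ => j • y) + fun _ => x := by
      ext; simp [add_comm]
    rw [h, f.map_add_univ, eval_finsetSum]
    refine Finset.sum_congr rfl fun s _ => ?_
    have h2 : s.piecewise (fun _ : Fin d => j • y) (fun _ => x) =
        s.piecewise (fun i => (fun _ : Fin d => j) i • s.piecewise (fun _ => y) (fun _ => x) i)
          (s.piecewise (fun _ => y) fun _ => x) := by
      ext i
      by_cases hi : i ∈ s <;> simp [hi]
    rw [h2, f.map_piecewise_smul, Finset.prod_const, nsmul_eq_mul, Nat.cast_pow, eval_mul,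
      eval_C, eval_pow, eval_X, mul_comm]
  have hdeg : p.natDegree < d := by
    refine Nat.lt_of_le_pred hd (natDegree_sum_le_of_forall_le _ _ fun s _ => ?_)
    by_cases hs : s = Finset.univ
    · subst hs
      rw [Finset.piecewise_univ, hy, C_0, zero_mul, natDegree_zero]
      exact Nat.zero_le _
    · have := Finset.card_lt_univ_of_notMem
        (not_forall.1 fun h => hs (Finset.eq_univ_iff_forall.2 h)).choose_spec
      exact (natDegree_C_mul_X_pow_le _ _).trans (Nat.le_pred_of_lt (by simpa using this))
  have hp : p = 0 := eq_zero_of_natDegree_lt_card_of_eval_eq_zero p hinj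
    (fun j => by rw [heval, hxy]) (by simpa using hdeg)
  simpa [hp] using (heval 0).symm

/-- The `N`-th finite difference of the diagonal of a `d`-additive map vanishes for `N > d`. -/
theorem MultilinearMap.sum_powerset_neg_one_pow_smul_diag_eq_zero {R ι M N : Type*} [CommSemiring R]
    [AddCommMonoid M] [AddCommGroup N] [Module R M] [Module R N] {d : ℕ}
    (f : MultilinearMap R (fun _ : Fin d => M) N) (a : ι → M) (s : Finset ι) (hs : d < s.card) :
    ∑ u ∈ s.powerset, (-1 : ℤ) ^ u.card • f (fun _ => ∑ i ∈ u, a i) = 0 := by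
  classical
  have hexp (u : Finset ι) (hu : u ∈ s.powerset) : f (fun _ => ∑ i ∈ u, a i) =
      ∑ r ∈ Fintype.piFinset fun _ : Fin d => s,
        if ∀ j, r j ∈ u then f fun j => a (r j) else 0 := by
    rw [f.map_sum_finset, ← Finset.sum_filter]
    refine Finset.sum_congr ?_ fun _ _ => rfl
    ext r
    simp only [Fintype.mem_piFinset, Finset.mem_filter]
    exact ⟨fun h => ⟨fun j => Finset.mem_powerset.1 hu (h j), h⟩, fun h => h.2⟩
  rw [Finset.sum_congr rfl fun u hu => by rw [hexp u hu, Finset.smul_sum], Finset.sum_comm]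
  refine Finset.sum_eq_zero fun r _ => ?_
  obtain ⟨i, his, hir⟩ : ∃ i ∈ s, i ∉ Finset.univ.image r := by
    refine Finset.exists_mem_notMem_of_card_lt_card (Finset.card_image_le.trans_lt ?_)
    simpa using hs
  rw [← Finset.insert_erase his, Finset.sum_powerset_insert (Finset.notMem_erase i s),
    ← Finset.sum_add_distrib]
  refine Finset.sum_eq_zero fun u hu => ?_
  have hiu : i ∉ u := fun h => Finset.notMem_erase i s (Finset.mem_powerset.1 hu h)
  have hiff : (∀ j, r j ∈ insert i u) ↔ ∀ j, r j ∈ u := by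
    refine forall_congr' fun j => ?_
    have : r j ≠ i := fun h => hir (by simp [← h])
    simp [this]
  simp only [hiff, Finset.card_insert_of_notMem hiu, pow_succ]
  split_ifs <;> simp

/-- The diagonal of a `d`-additive map vanishes at a finite sum as soon as it vanishes at all
subsums with at most `d` terms. -/
theorem MultilinearMap.diag_sum_eq_zero {R ι M N : Type*} [CommSemiring R]
    [AddCommMonoid M] [AddCommGroup N] [Module R M] [Module R N] {d : ℕ}
    (f : MultilinearMap R (fun _ : Fin d => M) N) (a : ι → M)
    (h : ∀ s : Finset ι, s.card ≤ d → f (fun _ => ∑ i ∈ s, a i) = 0) (s : Finset ι) :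
    f (fun _ => ∑ i ∈ s, a i) = 0 := by
  classical
  induction s using Finset.strongInduction with
  | H s ih =>
    rcases le_or_gt s.card d with hs | hs
    · exact h s hs
    have hsum := f.sum_powerset_neg_one_pow_smul_diag_eq_zero a s hs
    rw [Finset.sum_eq_single_of_mem s (Finset.mem_powerset_self s) fun u hu hus => by
      rw [ih u ((Finset.mem_powerset.1 hu).ssubset_of_ne hus), smul_zero]] at hsum
    rcases neg_one_pow_eq_or ℤ s.card with h1 | h1 <;> simpa [h1] using hsum

theorem Matrix.rank_add_le_rank_add_rank {m n K : Type*} [Finite m] [Fintype n] [Field K]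
    (A B : Matrix m n K) : (A + B).rank ≤ A.rank + B.rank := by
  rw [rank, rank, rank, mulVecLin_add]
  exact (Submodule.finrank_mono (LinearMap.range_add_le _ _)).trans
    (Submodule.finrank_add_le_finrank_add_finrank _ _)

theorem Matrix.rank_sum_le_card {ι n K : Type*} [Fintype n] [Field K] (a : ι → Matrix n n K)
    (ha : ∀ i, (a i).rank ≤ 1) (s : Finset ι) : (∑ i ∈ s, a i).rank ≤ s.card := by
  classical
  induction s using Finset.induction_on with
  | empty => simp
  | insert i s hi ih =>
    rw [Finset.sum_insert hi, Finset.card_insert_of_notMem hi, add_comm s.card]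
    exact (rank_add_le_rank_add_rank _ _).trans (add_le_add (ha i) ih)

/-- The `(m + 1)`-additive map `x ↦ [G (x₁, …, xₘ), x₀]` attached to an `m`-additive map `G`. -/
def MultilinearMap.commutatorTail {A : Type*} [Ring A] {m : ℕ}
    (G : MultilinearMap ℕ (fun _ : Fin m => A) A) :
    MultilinearMap ℕ (fun _ : Fin (m + 1) => A) A :=
  MultilinearMap.mk' (fun x => G (Fin.tail x) * x 0 - x 0 * G (Fin.tail x))
    (fun x i a b => by
      cases i using Fin.cases with
      | zero => simp [Fin.tail_update_zero, mul_add, add_mul]; abel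
      | succ i => simp [Fin.tail_update_succ, mul_add, add_mul, (Fin.succ_ne_zero i).symm]; abel)
    (fun x i c a => by
      cases i using Fin.cases with
      | zero => simp [-nsmul_eq_mul, Fin.tail_update_zero, smul_sub]
      | succ i =>
        simp [-nsmul_eq_mul, Fin.tail_update_succ, smul_sub, (Fin.succ_ne_zero i).symm])

/-- If `G` is a symmetric `m`-additive map whose trace commutes on all
rank-`k` matrices (`m + 1 ≤ k ≤ n`), then its trace commutes on all of `M_n(K)`. -/
theorem stmt_11 (K : Type*) [Field K] (m n : ℕ) (hm : 1 < m) (hn : m + 1 ≤ n)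
    (hchar : ringChar K = 0 ∨ m + 1 < ringChar K)
    (hcard : ((m + 4 : ℕ) : Cardinal) ≤ Cardinal.mk K)
    (k : ℕ) (hk1 : m + 1 ≤ k) (hkn : k ≤ n)
    (G : (Fin m → Matrix (Fin n) (Fin n) K) → Matrix (Fin n) (Fin n) K)
    (hadd : ∀ (x : Fin m → Matrix (Fin n) (Fin n) K) (r : Fin m)
      (a b : Matrix (Fin n) (Fin n) K),
      G (Function.update x r (a + b)) = G (Function.update x r a) + G (Function.update x r b))
    (hsymm : ∀ (σ : Equiv.Perm (Fin m)) (x : Fin m → Matrix (Fin n) (Fin n) K),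
      G (x ∘ σ) = G x)
    (hcomm : ∀ x : Matrix (Fin n) (Fin n) K, x.rank = k →
      G (fun _ => x) * x - x * G (fun _ => x) = 0) :
    ∀ x : Matrix (Fin n) (Fin n) K, G (fun _ => x) * x - x * G (fun _ => x) = 0 := by
  let F : MultilinearMap ℕ (fun _ : Fin m => Matrix (Fin n) (Fin n) K)
      (Matrix (Fin n) (Fin n) K) :=
    MultilinearMap.mk' G hadd fun x r c a =>
      (AddMonoidHom.mk' (fun a => G (Function.update x r a)) (hadd x r)).map_nsmul c a
  let T := F.commutatorTail
  have hT (x : Matrix (Fin n) (Fin n) K) :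
      T (fun _ => x) = G (fun _ => x) * x - x * G (fun _ => x) := rfl
  have hcast {j : ℕ} (hj : 0 < j) (hjm : j ≤ m + 1) : (j : K) ≠ 0 := fun h => by
    have hdvd := (ringChar.spec K j).1 h
    rcases hchar with h0 | h0
    · rw [h0, zero_dvd_iff] at hdvd
      omega
    · have := Nat.le_of_dvd hj hdvd
      omega
  have hinj : Function.Injective fun j : Fin (m + 1) => ((j + 1 : ℕ) : K) := by
    refine Function.Injective.of_lt_imp_ne fun i j hij h => ?_
    refine hcast (j := (j : ℕ) - i) (Nat.sub_pos_of_lt hij) (by omega) ?_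
    have h' : (i : ℕ) ≤ j := le_of_lt hij
    push_cast at h
    rw [Nat.cast_sub h', sub_eq_zero]
    exact (add_right_cancel h).symm
  have hle (x : Matrix (Fin n) (Fin n) K) (hx : x.rank ≤ k) : T (fun _ => x) = 0 := by
    rcases hx.eq_or_lt with hx | hx
    · exact hcomm x hx
    obtain ⟨y, hy, hxy⟩ := x.exists_rank_eq_and_rank_add_smul_eq (by simpa using hkn) hx
    ext a b
    refine MultilinearMap.diag_eq_zero_of_diag_add_nsmul_eq_zero
      ((Matrix.entryLinearMap ℕ K a b).compMultilinearMap T) m.succ_pos hinj x y ?_ fun j => ?_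
    · simpa [hT] using congrFun₂ (hcomm y hy) a b
    · have := hcomm _ (hxy _ (hcast j.val.succ_pos j.isLt))
      rw [Nat.cast_smul_eq_nsmul] at this
      simpa [hT] using congrFun₂ this a b
  intro x
  rw [← hT, matrix_eq_sum_single x, ← Fintype.sum_prod_type']
  refine T.diag_sum_eq_zero _ (fun s hs => hle _ ?_) _
  refine ((Matrix.rank_sum_le_card _ (fun i => ?_) s).trans hs).trans hk1
  have h : single i.1 i.2 (x i.1 i.2) =
      vecMulVec (x i.1 i.2 • Pi.single i.1 (1 : K)) (Pi.single i.2 1) := by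
    rw [smul_vecMulVec, ← single_eq_single_vecMulVec_single, smul_single, smul_eq_mul, mul_one]
  rw [h]
  exact rank_vecMulVec_le _ _
end

section
/- Let K be a field and let m, n be natural numbers with n ≥ m + 1 and m > 1. Let M_n(K) be the ring of n × n matrices over K with center Z = K·I. Assume char K = 0 or char K > m + 1, and that K contains at least m + 4 elements. Fix a natural number k with m + 1 ≤ k ≤ n. Let G : M_n(K)^m → M_n(K) be a symmetric m-additive map such that [G(x, …, x), x] = 0 for every rank-k matrix x ∈ M_n(K). Then there exist μ_0 ∈ Z and maps μ_i : M_n(K) → Z for i ∈ {1, …, m}, such that each μ_i is the trace of an i-additive map into Z, and G(x, …, x) = μ_0·x^m + μ_1(x)·x^{m−1} + … + μ_{m−1}(x)·x + μ_m(x) for each x ∈ M_n(K). -/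
/-- A map `T : M^p → A` is multiadditive if it is additive in each of its `p` arguments. -/
def MultiAdditive {M A : Type*} [AddCommMonoid M] [AddCommMonoid A] {p : ℕ}
    (T : (Fin p → M) → A) : Prop :=
  ∀ (x : Fin p → M) (r : Fin p) (a b : M),
    T (Function.update x r (a + b)) = T (Function.update x r a) + T (Function.update x r b)

section

open Matrix

/-- At least `N` natural numbers, with distinct images in `K`, avoid the root of `1 + t * w`. -/
def HasShifts {K : Type*} [Field K] (N : ℕ) (w : K) : Prop :=
  ∃ T : Finset ℕ, N ≤ T.card ∧ Set.InjOn (Nat.cast : ℕ → K) T ∧ ∀ t ∈ T, 1 + (t : K) * w ≠ 0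

theorem HasShifts.of_injOn {K : Type*} [Field K] {N : ℕ}
    (h : Set.InjOn (Nat.cast : ℕ → K) (Finset.range (N + 1))) (w : K) : HasShifts N w := by
  classical
  refine ⟨(Finset.range (N + 1)).filter fun t : ℕ => 1 + (t : K) * w ≠ 0, ?_, ?_, ?_⟩
  · have h1 : ((Finset.range (N + 1)).filter fun t : ℕ => ¬ (1 + (t : K) * w ≠ 0)).card ≤ 1 := by
      rw [Finset.card_le_one]
      intro a ha b hb
      simp only [ne_eq, not_not, Finset.mem_filter] at ha hb
      have hw : w ≠ 0 := by
        rintro rfl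
        simp at ha
      apply h (Finset.mem_coe.mpr ha.1) (Finset.mem_coe.mpr hb.1)
      apply mul_right_cancel₀ hw
      linear_combination ha.2 - hb.2
    have h2 := Finset.card_filter_add_card_filter_not (s := Finset.range (N + 1))
      (fun t : ℕ => 1 + (t : K) * w ≠ 0)
    rw [Finset.card_range] at h2
    omega
  · exact h.mono (by intro t ht; simp at ht ⊢; exact ht.1)
  · intro t ht
    exact (Finset.mem_filter.mp ht).2

theorem natCast_injOn_range {K : Type*} [Field K] {p N : ℕ} [CharP K p] (hN : N ≤ p) :
    Set.InjOn (Nat.cast : ℕ → K) (Finset.range N) := by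
  intro a ha b hb hab
  simp only [Finset.coe_range, Set.mem_Iio] at ha hb
  have := (CharP.natCast_eq_natCast K p).mp hab
  exact Nat.ModEq.eq_of_lt_of_lt this (by omega) (by omega)

theorem exists_hasShifts_split {K : Type*} [Field K] {m : ℕ}
    (hchar : ringChar K = 0 ∨ m + 1 < ringChar K)
    (hcard : ((m + 4 : ℕ) : Cardinal) ≤ Cardinal.mk K) (w : K) :
    ∃ α : K, HasShifts (m + 2) (α * w) ∧ HasShifts (m + 2) ((1 - α) * w) := by
  rcases hchar with h0 | hp
  · have : CharP K 0 := h0 ▸ ringChar.charP K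
    have : CharZero K := CharP.charP_to_charZero K
    exact ⟨0, .of_injOn Nat.cast_injective.injOn _, .of_injOn Nat.cast_injective.injOn _⟩
  · obtain ⟨p, hpK⟩ : ∃ p, ringChar K = p := ⟨_, rfl⟩
    rw [hpK] at hp
    have : CharP K p := hpK ▸ ringChar.charP K
    have hprime : Fact p.Prime := ⟨(CharP.char_is_prime_or_zero K p).resolve_right (by omega)⟩
    by_cases hp3 : m + 3 ≤ p
    · exact ⟨0, .of_injOn (natCast_injOn_range hp3) _, .of_injOn (natCast_injOn_range hp3) _⟩
    have hpm : p = m + 2 := by omega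
    let _ := ZMod.algebra K p
    let F := (algebraMap (ZMod p) K).fieldRange
    obtain ⟨α, hα⟩ : ∃ α : K, α ∉ F := by
      by_contra! hall
      have hsurj : Function.Surjective (algebraMap (ZMod p) K) := fun x => hall x
      have := Finite.of_surjective _ hsurj
      have hle := Nat.card_le_card_of_surjective _ hsurj
      rw [← Nat.cast_card, Nat.cast_le] at hcard
      rw [Nat.card_zmod] at hle
      omega
    by_cases hw : HasShifts (m + 2) w
    · refine ⟨1, by simpa using hw, Finset.range (m + 2), by simp,
        natCast_injOn_range hpm.ge, by simp⟩
    have key : ∀ β : K, β ∉ F → HasShifts (m + 2) (β * w) := by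
      intro β hβ
      refine ⟨Finset.range (m + 2), by simp, natCast_injOn_range hpm.ge, fun t _ ht => ?_⟩
      apply hw
      refine ⟨Finset.range (m + 2), by simp, natCast_injOn_range hpm.ge, fun s _ hs => ?_⟩
      have hs0 : (t : K) ≠ 0 := by
        intro h
        simp [h] at ht
      have hw0 : w ≠ 0 := by
        rintro rfl
        simp at ht
      have hβ' : β = s / t := by
        field_simp
        apply mul_right_cancel₀ hw0
        linear_combination ht - hs
      exact hβ (hβ' ▸ F.div_mem (natCast_mem F s) (natCast_mem F t))
    exact ⟨α, key α hα, key _ fun h => hα (by simpa using F.sub_mem F.one_mem h)⟩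

/-- A symmetric multilinear map whose trace vanishes on a set `R` that is stable under sufficiently
many shifts in the directions `X` vanishes on `X`. -/
theorem MultilinearMap.eq_zero_of_trace_eq_zero {M K : Type*} [AddCommGroup M] [Field K]
    {R X : Set M} (hR : R.Nonempty) {N : ℕ}
    (hRX : ∀ y ∈ R, ∀ x ∈ X, ∃ x₁ x₂, x = x₁ + x₂ ∧
      (∃ T : Finset ℕ, N < T.card ∧ Set.InjOn (Nat.cast : ℕ → K) T ∧ ∀ t ∈ T, y + t • x₁ ∈ R) ∧
      (∃ T : Finset ℕ, N < T.card ∧ Set.InjOn (Nat.cast : ℕ → K) T ∧ ∀ t ∈ T, y + t • x₂ ∈ R))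
    (hN : ∀ e : ℕ, 0 < e → e ≤ N → (e : K) ≠ 0) {e : ℕ} (he : e ≤ N)
    (S : MultilinearMap ℤ (fun _ : Fin e => M) K)
    (hS : ∀ (σ : Equiv.Perm (Fin e)) x, S (x ∘ σ) = S x)
    (hSR : ∀ y ∈ R, S (fun _ => y) = 0) (x : Fin e → M) (hx : ∀ i, x i ∈ X) : S x = 0 := by
  induction e with
  | zero =>
    obtain ⟨y, hy⟩ := hR
    rw [← hSR y hy]
    congr 1
    exact Subsingleton.elim _ _
  | succ e ih =>
    have deriv : ∀ y ∈ R, ∀ x, (∃ T : Finset ℕ, N < T.card ∧ Set.InjOn (Nat.cast : ℕ → K) T ∧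
        ∀ t ∈ T, y + t • x ∈ R) → S (Fin.cons x fun _ => y) = 0 := by
      rintro y - x ⟨T, hTN, hTinj, hT⟩
      let p : Polynomial K := ∑ s : Finset (Fin (e + 1)),
        Polynomial.C (S (s.piecewise (fun _ => x) fun _ => y)) * Polynomial.X ^ s.card
      have hp : p = 0 := by
        apply Polynomial.eq_zero_of_natDegree_lt_card_of_eval_eq_zero (ι := T) p
          (f := fun t => ((t : ℕ) : K)) (fun a b h => Subtype.ext (hTinj a.2 b.2 h))
        · rintro ⟨t, ht⟩
          rw [← hSR _ (hT t ht)]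
          have := S.map_add_univ (fun _ => (t : ℤ) • x) (fun _ => y)
          have h2 : ((fun _ => (t : ℤ) • x) + fun _ => y : Fin (e + 1) → M)
              = fun _ => y + t • x := by
            funext i
            simp [add_comm]
          rw [h2] at this
          rw [this, Polynomial.eval_finsetSum]
          refine Finset.sum_congr rfl fun s _ => ?_
          have h3 : s.piecewise (fun _ => (t : ℤ) • x) (fun _ => y)
              = s.piecewise (fun i => (t : ℤ) • (s.piecewise (fun _ => x) (fun _ => y) i))
                (s.piecewise (fun _ => x) (fun _ => y) : Fin (e + 1) → M) := by
            funext i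
            by_cases hi : i ∈ s <;> simp only [Finset.piecewise, hi, if_true, if_false]
          rw [h3, S.map_piecewise_smul (fun _ => (t : ℤ))]
          rw [Finset.prod_const, zsmul_eq_mul, Polynomial.eval_mul, Polynomial.eval_C,
            Polynomial.eval_pow, Polynomial.eval_X, mul_comm]
          push_cast
          rfl
        · refine lt_of_le_of_lt ?_ (lt_of_le_of_lt he (by simpa using hTN))
          apply Polynomial.natDegree_sum_le_of_forall_le
          intro s _
          refine (Polynomial.natDegree_C_mul_X_pow_le _ _).trans ?_
          simpa using s.card_le_univ
      have h1 : p.coeff 1 = (e + 1 : ℕ) * S (Fin.cons x fun _ => y) := by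
        simp only [p, Polynomial.finsetSum_coeff, Polynomial.coeff_C_mul_X_pow]
        rw [← Finset.sum_filter]
        have : (Finset.univ.filter fun s : Finset (Fin (e + 1)) => 1 = s.card)
            = Finset.univ.map ⟨fun i : Fin (e + 1) => ({i} : Finset (Fin (e + 1))),
              Finset.singleton_injective⟩ := by
          ext s
          simp only [Finset.mem_filter, Finset.mem_univ, true_and, Finset.mem_map,
            Function.Embedding.coeFn_mk]
          rw [eq_comm, Finset.card_eq_one]
          exact exists_congr fun _ => eq_comm
        rw [this, Finset.sum_map]
        have h4 : ∀ i : Fin (e + 1), S (({i} : Finset (Fin (e + 1))).piecewise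
            (fun _ => x) fun _ => y) = S (Fin.cons x fun _ => y) := by
          intro i
          rw [← hS (Equiv.swap 0 i)]
          congr 1
          funext j
          refine Fin.cases ?_ (fun j => ?_) j
          · simp
          · have : Equiv.swap 0 i j.succ ≠ i := by
              rw [Ne, Equiv.swap_apply_eq_iff]
              simp
            simp [this]
        simp [h4]
      rw [hp, Polynomial.coeff_zero] at h1
      exact (mul_eq_zero.mp h1.symm).resolve_left (hN _ (Nat.succ_pos e) he)
    have h := ih (by omega) (S.curryLeft (x 0)) (fun σ z => by
        rw [S.curryLeft_apply, S.curryLeft_apply,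
          ← hS (Equiv.Perm.decomposeFin.symm (0, σ)) (Fin.cons (x 0) z)]
        congr 1
        funext j
        refine Fin.cases ?_ (fun j => ?_) j <;> simp) (fun y hy => by
        obtain ⟨x₁, x₂, h12, h1, h2⟩ := hRX y hy _ (hx 0)
        rw [h12, map_add, _root_.add_apply, S.curryLeft_apply, S.curryLeft_apply,
          deriv y hy _ h1, deriv y hy _ h2, add_zero]) (Fin.tail x) (fun i => hx _)
    rwa [S.curryLeft_apply, Fin.cons_self_tail] at h

theorem Matrix.single_eq_vecMulVec_single_one {N K : Type*} [DecidableEq N] [Field K]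
    (a b : N) (c : K) : single a b c = vecMulVec (Pi.single a 1) (Pi.single b c) := by
  ext i j
  by_cases hi : a = i <;> by_cases hj : b = j <;>
    simp [vecMulVec_apply, hi, hj, eq_comm]

theorem Matrix.single_eq_vecMulVec_one_single {N K : Type*} [DecidableEq N] [Field K]
    (a b : N) (c : K) : single a b c = vecMulVec (Pi.single a c) (Pi.single b 1) := by
  ext i j
  by_cases hi : a = i <;> by_cases hj : b = j <;>
    simp [vecMulVec_apply, hi, hj, eq_comm]

theorem Matrix.isUnit_det_one_add_vecMulVec {N K : Type*} [Fintype N] [DecidableEq N] [Field K]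
    {u v : N → K} (h : 1 + v ⬝ᵥ u ≠ 0) : IsUnit (1 + vecMulVec u v).det := by
  rw [vecMulVec_eq Unit, det_one_add_replicateCol_mul_replicateRow]
  exact h.isUnit

/-- The matrices of rank `k` whose range contains the basis vectors indexed by `A` and whose row
space contains those indexed by `B`. -/
def rankFrame {N K : Type*} [Fintype N] [DecidableEq N] [Field K] (k : ℕ) (A B : Finset N) :
    Set (Matrix N N K) :=
  {y | y.rank = k ∧ (∀ a ∈ A, ∃ p, y *ᵥ p = Pi.single a 1) ∧ ∀ b ∈ B, ∃ q, q ᵥ* y = Pi.single b 1}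

theorem rankFrame_nonempty {N K : Type*} [Fintype N] [DecidableEq N] [Field K] {k : ℕ}
    {A B : Finset N} (hA : A.card ≤ k) (hB : B.card ≤ k) (hk : k ≤ Fintype.card N) :
    (rankFrame k A B : Set (Matrix N N K)).Nonempty := by
  classical
  obtain ⟨A', hAA', -, hA'⟩ := Finset.exists_subsuperset_card_eq (Finset.subset_univ A) hA
    (by simpa using hk)
  obtain ⟨B', hBB', -, hB'⟩ := Finset.exists_subsuperset_card_eq (Finset.subset_univ B) hB
    (by simpa using hk)
  let e : {x // x ∈ A'} ≃ {x // x ∈ B'} := Finset.equivOfCardEq (hA'.trans hB'.symm)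
  let φ : Equiv.Perm N := e.extendSubtype
  let y : Matrix N N K := fun a b => if a ∈ A' ∧ b = φ a then 1 else 0
  refine ⟨y, ?_, fun a ha => ⟨Pi.single (φ a) 1, ?_⟩, fun b hb => ⟨Pi.single (φ.symm b) 1, ?_⟩⟩
  · have hy : y = (Matrix.diagonal fun a => if a ∈ A' then (1 : K) else 0).submatrix
        (Equiv.refl N) φ.symm := by
      ext a b
      simp only [y, submatrix_apply, diagonal_apply, Equiv.refl_apply, Equiv.eq_symm_apply,
        eq_comm (a := b)]
      split_ifs <;> simp_all
    rw [hy, Matrix.rank_submatrix, Matrix.rank_diagonal]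
    simp [hA']
  · ext c
    rw [mulVec_single_one]
    change y c (φ a) = _
    have h : a ∈ A' := hAA' ha
    by_cases hc : c = a
    · simp [y, hc, h]
    · simp [y, hc, Ne.symm hc]
  · ext c
    rw [single_one_vecMul]
    have : φ.symm b ∈ A' := by
      by_contra h
      have := e.extendSubtype_not_mem _ h
      simp [φ] at this
      exact this (hBB' hb)
    change y (φ.symm b) c = _
    simp [y, this, Pi.single_apply]

theorem add_single_mem_rankFrame {N K : Type*} [Fintype N] [DecidableEq N] [Field K] {k : ℕ}
    {A B : Finset N} {y : Matrix N N K} (hy : y ∈ rankFrame k A B) {a b : N} {p q : N → K}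
    (hp : y *ᵥ p = Pi.single a 1) (hq : q ᵥ* y = Pi.single b 1) {c : K} (hc : 1 + c * p b ≠ 0) :
    y + Matrix.single a b c ∈ rankFrame k A B := by
  have h1 : y + Matrix.single a b c = y * (1 + vecMulVec p (Pi.single b c)) := by
    rw [mul_add, mul_one, mul_vecMulVec, hp, single_eq_vecMulVec_single_one]
  have h2 : y + Matrix.single a b c = (1 + vecMulVec (Pi.single a c) q) * y := by
    rw [add_mul, one_mul, vecMulVec_mul, hq, single_eq_vecMulVec_one_single]
  have hpq : q a = p b := by
    have : q ⬝ᵥ (y *ᵥ p) = (q ᵥ* y) ⬝ᵥ p := dotProduct_mulVec q y p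
    rw [hp, hq] at this
    simpa using this
  have hU : IsUnit (1 + vecMulVec p (Pi.single b c)).det :=
    isUnit_det_one_add_vecMulVec (by simpa using hc)
  have hV : IsUnit (1 + vecMulVec (Pi.single a c) q).det :=
    isUnit_det_one_add_vecMulVec (by simpa [hpq, mul_comm] using hc)
  refine ⟨?_, fun a' ha' => ?_, fun b' hb' => ?_⟩
  · rw [h1, rank_mul_eq_left_of_isUnit_det _ _ hU, hy.1]
  · obtain ⟨p', hp'⟩ := hy.2.1 a' ha'
    refine ⟨(1 + vecMulVec p (Pi.single b c))⁻¹ *ᵥ p', ?_⟩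
    rw [h1, mulVec_mulVec, mul_assoc, mul_nonsing_inv _ hU, mul_one, hp']
  · obtain ⟨q', hq'⟩ := hy.2.2 b' hb'
    refine ⟨q' ᵥ* (1 + vecMulVec (Pi.single a c) q)⁻¹, ?_⟩
    rw [h2, vecMul_vecMul, ← mul_assoc, nonsing_inv_mul _ hV, one_mul, hq']

theorem MultilinearMap.eq_zero_of_single {N K A : Type*} [Fintype N] [DecidableEq N] [Field K]
    [AddCommGroup A] {e : ℕ} (S : MultilinearMap ℤ (fun _ : Fin e => Matrix N N K) A)
    (h : ∀ (a b : Fin e → N) (c : Fin e → K), S (fun i => Matrix.single (a i) (b i) (c i)) = 0)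
    (x : Fin e → Matrix N N K) : S x = 0 := by
  have hx : x = fun i => ∑ p : N × N, Matrix.single p.1 p.2 (x i p.1 p.2) := by
    funext i
    rw [Fintype.sum_prod_type]
    exact matrix_eq_sum_single (x i)
  rw [hx, S.map_sum]
  exact Finset.sum_eq_zero fun r _ => h (fun i => (r i).1) (fun i => (r i).2) _

theorem MultilinearMap.eq_zero_of_trace_eq_zero_of_rank_eq {N K : Type*} [Fintype N]
    [DecidableEq N] [Field K] {m k : ℕ}
    (hshift : ∀ w : K, ∃ α : K, HasShifts (m + 2) (α * w) ∧ HasShifts (m + 2) ((1 - α) * w))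
    (hm : ∀ e : ℕ, 0 < e → e ≤ m + 1 → (e : K) ≠ 0) (hk : m + 1 ≤ k) (hkN : k ≤ Fintype.card N)
    {e : ℕ} (he : e ≤ m + 1) (S : MultilinearMap ℤ (fun _ : Fin e => Matrix N N K) K)
    (hS : ∀ (σ : Equiv.Perm (Fin e)) x, S (x ∘ σ) = S x)
    (hSR : ∀ y : Matrix N N K, y.rank = k → S (fun _ => y) = 0) (x : Fin e → Matrix N N K) :
    S x = 0 := by
  refine S.eq_zero_of_single (fun a b c => ?_) x
  have hcard : ∀ f : Fin e → N, (Finset.univ.image f).card ≤ k := fun f =>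
    (Finset.card_image_le.trans (by simp)).trans (he.trans hk)
  refine S.eq_zero_of_trace_eq_zero (R := rankFrame k (Finset.univ.image a) (Finset.univ.image b))
    (X := {x | ∃ i j c, x = Matrix.single (a i) (b j) c})
    (rankFrame_nonempty (hcard a) (hcard b) hkN) ?_ hm he hS (fun y hy => hSR y hy.1) _
    (fun i => ⟨i, i, c i, rfl⟩)
  rintro y hy _ ⟨i, j, c, rfl⟩
  obtain ⟨p, hp⟩ := hy.2.1 (a i) (by simp)
  obtain ⟨q, hq⟩ := hy.2.2 (b j) (by simp)
  have key : ∀ c : K, HasShifts (m + 2) (c * p (b j)) → ∃ T : Finset ℕ, m + 1 < T.card ∧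
      Set.InjOn (Nat.cast : ℕ → K) T ∧ ∀ t ∈ T, y + t • Matrix.single (a i) (b j) c ∈
        rankFrame k (Finset.univ.image a) (Finset.univ.image b) := by
    rintro c ⟨T, hT, hinj, h⟩
    refine ⟨T, hT, hinj, fun t ht => ?_⟩
    rw [smul_single, nsmul_eq_mul]
    exact add_single_mem_rankFrame hy hp hq (by rw [mul_assoc]; exact h t ht)
  obtain ⟨α, h1, h2⟩ := hshift (c * p (b j))
  refine ⟨Matrix.single (a i) (b j) (α * c), Matrix.single (a i) (b j) ((1 - α) * c), ?_,
    key _ (by rwa [mul_assoc]), key _ (by rwa [mul_assoc])⟩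
  rw [← single_add]
  congr 1
  ring

/-- The `(r, s)` entry of the commutator `[G (x₁, …, x_d), x₀]`, as a multilinear map. -/
def commutatorEntry {N K : Type*} [Fintype N] [Field K] {d : ℕ}
    (G : MultilinearMap ℤ (fun _ : Fin d => Matrix N N K) (Matrix N N K)) (r s : N) :
    MultilinearMap ℤ (fun _ : Fin (d + 1) => Matrix N N K) K :=
  LinearMap.uncurryLeft (M := fun _ : Fin (d + 1) => Matrix N N K)
    { toFun := fun x₀ =>
        (AddMonoidHom.mk' (fun A : Matrix N N K => (A * x₀ - x₀ * A) r s) (fun A B => by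
          simp only [add_mul, mul_add, Matrix.sub_apply, Matrix.add_apply]
          ring)).toIntLinearMap.compMultilinearMap G
      map_add' := fun x y => by
        ext z
        simp only [LinearMap.compMultilinearMap_apply, AddMonoidHom.coe_toIntLinearMap,
          AddMonoidHom.mk'_apply, _root_.add_apply, add_mul, mul_add, Matrix.sub_apply,
          Matrix.add_apply]
        ring
      map_smul' := fun c x => by
        ext z
        simp [smul_sub] }

theorem commutatorEntry_apply {N K : Type*} [Fintype N] [Field K] {d : ℕ}
    (G : MultilinearMap ℤ (fun _ : Fin d => Matrix N N K) (Matrix N N K)) (r s : N)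
    (x : Fin (d + 1) → Matrix N N K) :
    commutatorEntry G r s x =
      (G (fun j => x j.succ) * x 0 - x 0 * G (fun j => x j.succ)) r s := rfl

theorem factorial_ne_zero_of_le {K : Type*} [Field K] {m : ℕ}
    (hm : ∀ e : ℕ, 0 < e → e ≤ m → (e : K) ≠ 0) {e : ℕ} (he : e ≤ m) : (e.factorial : K) ≠ 0 := by
  induction e with
  | zero => simp
  | succ e ih =>
    rw [Nat.factorial_succ, Nat.cast_mul]
    exact mul_ne_zero (hm _ e.succ_pos he) (ih (by omega))

section

variable {N K : Type*} [Fintype N] [DecidableEq N] [Field K] {m k : ℕ}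
  (hshift : ∀ w : K, ∃ α : K, HasShifts (m + 2) (α * w) ∧ HasShifts (m + 2) ((1 - α) * w))
  (hm : ∀ e : ℕ, 0 < e → e ≤ m + 1 → (e : K) ≠ 0) (hk : m + 1 ≤ k) (hkN : k ≤ Fintype.card N)
  {d : ℕ} (hd : d ≤ m) (G : MultilinearMap ℤ (fun _ : Fin d => Matrix N N K) (Matrix N N K))
  (hG : ∀ y : Matrix N N K, y.rank = k → G (fun _ => y) * y - y * G (fun _ => y) = 0)

include hshift hm hk hkN hd hG

theorem sum_perm_commutator_eq_zero (x : Fin (d + 1) → Matrix N N K) :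
    ∑ σ : Equiv.Perm (Fin (d + 1)),
      (G (fun j => x (σ j.succ)) * x (σ 0) - x (σ 0) * G (fun j => x (σ j.succ))) = 0 := by
  ext r s
  have h := MultilinearMap.eq_zero_of_trace_eq_zero_of_rank_eq hshift hm hk hkN
    (Nat.succ_le_succ hd) (∑ σ : Equiv.Perm (Fin (d + 1)), (commutatorEntry G r s).domDomCongr σ)
    (fun τ z => by
      simp only [_root_.sum_apply, MultilinearMap.domDomCongr_apply]
      exact Fintype.sum_equiv (Equiv.mulLeft τ) _ _ fun σ => rfl)
    (fun y hy => by
      simp only [_root_.sum_apply, MultilinearMap.domDomCongr_apply, commutatorEntry_apply]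
      exact Finset.sum_eq_zero fun σ _ => by rw [hG y hy]; rfl) x
  simpa [_root_.sum_apply, MultilinearMap.domDomCongr_apply, commutatorEntry_apply,
    Matrix.sum_apply] using h

theorem commute_trace_of_rank_eq (x : Matrix N N K) :
    G (fun _ => x) * x - x * G (fun _ => x) = 0 := by
  have h := sum_perm_commutator_eq_zero hshift hm hk hkN hd G hG (fun _ => x)
  rw [Finset.sum_const, Finset.card_univ, Fintype.card_perm, Fintype.card_fin,
    ← Nat.cast_smul_eq_nsmul K] at h
  exact (smul_eq_zero.mp h).resolve_left (factorial_ne_zero_of_le hm (by omega))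

end

/-- The common form of the commuting identity after polarization, tested against a row `α`
vanishing on all arguments and a vector `w` in the kernel of all arguments. -/
def IsPolarCommuting {N K : Type*} [Fintype N] [DecidableEq N] [Field K] {d : ℕ}
    (G : MultilinearMap ℤ (fun _ : Fin d => Matrix N N K) (Matrix N N K)) : Prop :=
  ∀ (α : N) (w : N → K) (y : Fin d → Matrix N N K), (∀ i, y i α = 0) → (∀ i, y i *ᵥ w = 0) →
    ∀ p q, G y α p * w q = if α = p then (G y *ᵥ w) q else 0

theorem isPolarCommuting_sum_perm {N K : Type*} [Fintype N] [DecidableEq N] [Field K] {d : ℕ}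
    (G : MultilinearMap ℤ (fun _ : Fin d => Matrix N N K) (Matrix N N K))
    (hG : ∀ x : Fin (d + 1) → Matrix N N K, ∑ σ : Equiv.Perm (Fin (d + 1)),
      (G (fun j => x (σ j.succ)) * x (σ 0) - x (σ 0) * G (fun j => x (σ j.succ))) = 0) :
    IsPolarCommuting (∑ τ : Equiv.Perm (Fin d), G.domDomCongr τ) := by
  intro α w y hα hw p q
  have h := congrArg (fun A => (A *ᵥ w) α) (hG (Fin.cons (Matrix.single p q 1) y))
  simp only [sum_mulVec, Finset.sum_apply, zero_mulVec, Pi.zero_apply] at h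
  rw [← Equiv.sum_comp Equiv.Perm.decomposeFin.symm, Fintype.sum_prod_type, Fin.sum_univ_succ] at h
  have h0 : ∀ (A : Matrix N N K) (i : Fin d), ((A * y i - y i * A) *ᵥ w) α = 0 := by
    intro A i
    rw [sub_mulVec, ← mulVec_mulVec w A (y i), hw, mulVec_zero, ← mulVec_mulVec w (y i) A,
      zero_sub]
    change -((y i α) ⬝ᵥ (A *ᵥ w)) = 0
    rw [hα]
    simp
  simp only [Equiv.Perm.decomposeFin_symm_apply_zero, Fin.cons_succ, h0, Finset.sum_const_zero,
    add_zero, Equiv.Perm.decomposeFin_symm_apply_succ, Equiv.swap_self, Equiv.refl_apply,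
    Fin.cons_zero] at h
  set B := (∑ τ : Equiv.Perm (Fin d), G.domDomCongr τ) y with hB
  have h1 : ((B * Matrix.single p q 1 - Matrix.single p q 1 * B) *ᵥ w) α = 0 := by
    rw [← h, hB, _root_.sum_apply, Finset.sum_mul, Finset.mul_sum,
      ← Finset.sum_sub_distrib, sum_mulVec, Finset.sum_apply]
    rfl
  rw [sub_mulVec, Pi.sub_apply, sub_eq_zero, ← mulVec_mulVec, ← mulVec_mulVec] at h1
  have h2 : Matrix.single p q (1 : K) *ᵥ w = Pi.single p (w q) := by
    rw [single_eq_vecMulVec_single_one, vecMulVec_mulVec]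
    ext i
    simp [Pi.single_apply]
  have h3 : (Matrix.single p q (1 : K) *ᵥ (B *ᵥ w)) = Pi.single p ((B *ᵥ w) q) := by
    rw [single_eq_vecMulVec_single_one, vecMulVec_mulVec]
    ext i
    simp [Pi.single_apply]
  rw [h2, h3] at h1
  simpa [Pi.single_apply] using h1

theorem exists_multilinearMap_single {N K A : Type*} [Fintype N] [DecidableEq N] [Field K]
    [AddCommGroup A] {e : ℕ}
    (t : (Fin e → N) → (Fin e → N) → MultilinearMap ℤ (fun _ : Fin e => K) A) :
    ∃ T : MultilinearMap ℤ (fun _ : Fin e => Matrix N N K) A,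
      ∀ a b c, T (fun i => Matrix.single (a i) (b i) (c i)) = t a b c := by
  refine ⟨∑ a, ∑ b, (t a b).compLinearMap fun i => Matrix.entryLinearMap ℤ K (a i) (b i),
    fun a b c => ?_⟩
  simp only [_root_.sum_apply, MultilinearMap.compLinearMap_apply, Matrix.entryLinearMap_apply]
  rw [Finset.sum_eq_single a, Finset.sum_eq_single b]
  · simp
  · intro b' _ hb
    obtain ⟨i, hi⟩ := Function.ne_iff.mp hb
    exact MultilinearMap.map_coord_zero _ i (by simp [hi.symm])
  · simp
  · intro a' _ ha
    obtain ⟨i, hi⟩ := Function.ne_iff.mp ha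
    exact Finset.sum_eq_zero fun b' _ =>
      MultilinearMap.map_coord_zero _ i (by simp [hi.symm])
  · simp

theorem exists_forall_ne {N : Type*} [Fintype N] [DecidableEq N] {e : ℕ}
    (he : e < Fintype.card N) (b : Fin e → N) : ∃ β, ∀ i, b i ≠ β := by
  by_contra! h
  have := Fintype.card_le_of_surjective b h
  simp at this
  omega

/-- Matrices with prescribed single nonzero rows that kill `w` are sent to a matrix killing `w`. -/
def KillsOrthogonal {N K : Type*} [Fintype N] [DecidableEq N] [Field K] {e : ℕ}
    (G : MultilinearMap ℤ (fun _ : Fin e => Matrix N N K) (Matrix N N K)) : Prop :=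
  ∀ (a : Fin e → N) (v : Fin e → N → K) (w : N → K), (∀ i, v i ⬝ᵥ w = 0) →
    G (fun i => vecMulVec (Pi.single (a i) 1) (v i)) *ᵥ w = 0

section

variable {N K : Type*} [Fintype N] [DecidableEq N] [Field K] {e : ℕ}
  {G : MultilinearMap ℤ (fun _ : Fin e => Matrix N N K) (Matrix N N K)}

theorem IsPolarCommuting.killsOrthogonal (he : e < Fintype.card N) (hG : IsPolarCommuting G)
    (h : ∀ (a b : Fin e → N) (c : Fin e → K), ∃ β, (∀ i, b i ≠ β) ∧
      G (fun i => Matrix.single (a i) (b i) (c i)) β β = 0) : KillsOrthogonal G := by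
  intro a v w hw
  obtain ⟨α, hα⟩ := exists_forall_ne he a
  have hrow : G (fun i => vecMulVec (Pi.single (a i) 1) (v i)) α = 0 := by
    have hv : (fun i => vecMulVec (Pi.single (a i) 1) (v i)) =
        fun i => ∑ b, Matrix.single (a i) b (v i b) := by
      funext i
      ext p q
      rw [Matrix.sum_apply, Finset.sum_eq_single q]
      · by_cases hp : a i = p <;> simp [vecMulVec_apply, hp, Ne.symm]
      · intro b _ hb
        simp [hb]
      · simp
    ext p
    rw [hv, G.map_sum, Matrix.sum_apply]
    refine Finset.sum_eq_zero fun b _ => ?_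
    obtain ⟨β, hβ, h0⟩ := h a b fun i => v i (b i)
    have h1 := hG α (Pi.single β 1) (fun i => Matrix.single (a i) (b i) (v i (b i)))
      (fun i => by
        ext j
        simp [hα i])
      (fun i => by
        ext j
        simp [hβ i]) p β
    simpa [h0] using h1
  ext q
  have h1 := hG α w (fun i => vecMulVec (Pi.single (a i) 1) (v i))
    (fun i => by
      ext j
      simp [vecMulVec_apply, (hα i).symm])
    (fun i => by rw [vecMulVec_mulVec, hw]; simp) α q
  rw [hrow] at h1
  simpa using h1.symm

namespace KillsOrthogonal

variable (hG : KillsOrthogonal G)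
include hG

theorem apply_single_eq_zero {a b : Fin e → N} {c : Fin e → K} {β : N} (hβ : ∀ i, b i ≠ β) (r : N) :
    G (fun i => Matrix.single (a i) (b i) (c i)) r β = 0 := by
  have h := congrFun (hG a (fun i => Pi.single (b i) (c i)) (Pi.single β 1)
    (fun i => by simp [hβ i])) r
  simpa [single_eq_vecMulVec_single_one] using h

theorem apply_single_of_ne {a b : Fin e → N} {c : Fin e → K} {i : Fin e} {β : N}
    (hb : ∀ j, j ≠ i → b j ≠ b i) (hβ : ∀ j, j ≠ i → b j ≠ β) (hβi : b i ≠ β) (r : N) :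
    G (fun j => Matrix.single (a j) (b j) (c j)) r (b i) =
      c i * G (fun j => Matrix.single (a j) (Function.update b i β j)
        (Function.update c i 1 j)) r β := by
  have h := congrFun (hG a
    (Function.update (fun j => Pi.single (b j) (c j)) i (Pi.single (b i) (c i) - Pi.single β 1))
    (Pi.single (b i) 1 + Pi.single β (c i)) (fun j => by
      by_cases hj : j = i
      · subst hj
        simp [dotProduct_add, hβi, hβi.symm]
      · simp [hj, dotProduct_add, hb j hj, hβ j hj])) r
  have h1 : (fun j => vecMulVec (Pi.single (a j) 1) (Function.update
      (fun j => Pi.single (b j) (c j)) i (Pi.single (b i) (c i) - Pi.single β (1 : K)) j)) =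
      Function.update (fun j => Matrix.single (a j) (b j) (c j)) i
        (Matrix.single (a i) (b i) (c i) - Matrix.single (a i) β 1) := by
    funext j
    by_cases hj : j = i
    · subst hj
      simp [single_eq_vecMulVec_single_one, vecMulVec_sub]
    · simp [hj, single_eq_vecMulVec_single_one]
  have h2 : Function.update (fun j => Matrix.single (a j) (b j) (c j)) i
        (Matrix.single (a i) β 1) = fun j => Matrix.single (a j) (Function.update b i β j)
        (Function.update c i 1 j) := by
    funext j
    by_cases hj : j = i
    · subst hj
      simp
    · simp [hj]
  have h3 : G (fun j => Matrix.single (a j) (b j) (c j)) r β = 0 :=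
    hG.apply_single_eq_zero (fun j => by
      by_cases hj : j = i
      · rwa [hj]
      · exact hβ j hj) r
  have h4 : G (fun j => Matrix.single (a j) (Function.update b i β j)
      (Function.update c i 1 j)) r (b i) = 0 :=
    hG.apply_single_eq_zero (fun j => by
      by_cases hj : j = i
      · subst hj
        simpa using hβi.symm
      · simpa [hj] using hb j hj) r
  rw [h1, G.map_update_sub, Function.update_eq_self, h2] at h
  simp only [mulVec_add, Matrix.sub_apply, Pi.add_apply, mulVec_single, h3, h4,
    Matrix.col_apply, Pi.smul_apply, MulOpposite.smul_eq_mul_unop, MulOpposite.unop_op,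
    Pi.zero_apply] at h
  linear_combination h

theorem apply_single {a b : Fin e → N} {c : Fin e → K} {i : Fin e} {β : N}
    (he : e < Fintype.card N)
    (hb : ∀ j, j ≠ i → b j ≠ b i) (hβ : ∀ j, j ≠ i → b j ≠ β) (r : N) :
    G (fun j => Matrix.single (a j) (b j) (c j)) r (b i) =
      c i * G (fun j => Matrix.single (a j) (Function.update b i β j)
        (Function.update c i 1 j)) r β := by
  by_cases hβi : b i = β
  · subst hβi
    obtain ⟨γ, hγ⟩ := exists_forall_ne he b
    rw [hG.apply_single_of_ne hb (fun j _ => hγ j) (hγ i)]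
    have := hG.apply_single_of_ne (a := a) (c := Function.update c i 1) hb (fun j _ => hγ j) (hγ i) r
    simp only [Function.update_self, Function.update_idem, one_mul, Function.update_eq_self] at this ⊢
    rw [this]
  · exact hG.apply_single_of_ne hb hβ hβi r

theorem eq_zero (he : e < Fintype.card N)
    (h : ∀ (a b : Fin e → N) (c : Fin e → K) (i : Fin e), (∀ j, j ≠ i → b j ≠ b i) →
      ∀ r, G (fun j => Matrix.single (a j) (b j) (c j)) r (b i) = 0)
    (x : Fin e → Matrix N N K) : G x = 0 := by
  refine G.eq_zero_of_single (fun a b c => ?_) x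
  ext r β
  rw [Matrix.zero_apply]
  obtain ⟨s, hs⟩ : ∃ s, (Finset.univ.filter fun i => b i = β).card = s := ⟨_, rfl⟩
  induction s using Nat.strong_induction_on generalizing b c β with
  | _ s ih =>
  by_cases hs0 : s = 0
  · subst hs0
    rw [Finset.card_eq_zero, Finset.filter_eq_empty_iff] at hs
    exact hG.apply_single_eq_zero (fun i => hs (Finset.mem_univ i)) r
  by_cases hs1 : s = 1
  · subst hs1
    obtain ⟨i, hi⟩ := Finset.card_eq_one.mp hs
    have hmem : ∀ j, b j = β ↔ j = i := fun j => by
      simpa using Finset.ext_iff.mp hi j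
    obtain rfl := (hmem i).mpr rfl
    exact h a b c i (fun j hj hji => hj ((hmem j).mp hji)) r
  set S := Finset.univ.filter fun i => b i = β with hS
  have hbS : ∀ i, i ∈ S ↔ b i = β := fun i => by simp [hS]
  obtain ⟨f, hf, hfinj⟩ : ∃ f : Fin e → N, (∀ i ∈ S, ∀ j, b j ≠ f i) ∧ Set.InjOn f S := by
    have hc1 : (Finset.univ.image b).card ≤ e - s + 1 := by
      have hsub : Finset.univ.image b ⊆ insert β (Sᶜ.image b) := by
        intro x hx
        obtain ⟨i, -, rfl⟩ := Finset.mem_image.mp hx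
        by_cases hi : b i = β
        · simp [hi]
        · exact Finset.mem_insert_of_mem (Finset.mem_image_of_mem b (by simp [hbS, hi]))
      refine (Finset.card_le_card hsub).trans ((Finset.card_insert_le _ _).trans ?_)
      have := Finset.card_image_le (s := Sᶜ) (f := b)
      rw [Finset.card_compl, hs, Fintype.card_fin] at this
      omega
    have hse : s ≤ e := by
      rw [← hs]
      simpa using S.card_le_univ
    have hc2 : Fintype.card S ≤ Fintype.card ((Finset.univ.image b)ᶜ : Finset N) := by
      rw [Fintype.card_coe, Fintype.card_coe, Finset.card_compl, hs]
      omega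
    obtain ⟨g⟩ := Function.Embedding.nonempty_of_card_le hc2
    refine ⟨fun i => if hi : i ∈ S then g ⟨i, hi⟩ else β, fun i hi j => ?_, fun i hi j hj hij => ?_⟩
    · have := (g ⟨i, hi⟩).2
      simp only [Finset.mem_compl, Finset.mem_image, Finset.mem_univ, true_and, not_exists] at this
      simpa [hi] using this j
    · rw [Finset.mem_coe] at hi hj
      simpa [hi, hj, Subtype.ext_iff] using hij
  obtain ⟨i₀, hi₀⟩ : S.Nonempty := by
    rw [← Finset.card_pos]
    omega
  have hfβ : ∀ i ∈ S, f i ≠ β := fun i hi => by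
    rw [← (hbS i₀).mp hi₀]
    exact (hf i hi i₀).symm
  let w : N → K := fun x => if x = β ∨ ∃ j ∈ S, f j = x then 1 else 0
  have hw := congrFun (hG a (fun i => if i ∈ S then Pi.single (f i) (-c i) + Pi.single (b i) (c i)
    else Pi.single (b i) (c i)) w (fun i => by
      split_ifs with hi
      · have h1 : w (f i) = 1 := if_pos (Or.inr ⟨i, hi, rfl⟩)
        have h2 : w (b i) = 1 := if_pos (Or.inl ((hbS i).mp hi))
        simp [add_dotProduct, h1, h2]
      · have h1 : w (b i) = 0 := if_neg (by
          rintro (h | ⟨j, hj, h⟩)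
          · exact hi ((hbS i).mpr h)
          · exact hf j hj i h.symm)
        simp [h1])) r
  have hsplit : (fun i => vecMulVec (Pi.single (a i) 1) (if i ∈ S then
      Pi.single (f i) (-c i) + Pi.single (b i) (c i) else Pi.single (b i) (c i))) =
      (fun i => if i ∈ S then Matrix.single (a i) (f i) (-c i) else 0) +
      fun i => Matrix.single (a i) (b i) (c i) := by
    funext i
    by_cases hi : i ∈ S <;> simp [hi, single_eq_vecMulVec_single_one, vecMulVec_add]
  rw [hsplit, G.map_add_univ, sum_mulVec, Finset.sum_apply, Pi.zero_apply,
    Finset.sum_eq_single ∅] at hw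
  · rw [Finset.piecewise_empty] at hw
    change ∑ x, G (fun i => Matrix.single (a i) (b i) (c i)) r x * w x = 0 at hw
    rw [Finset.sum_eq_single β] at hw
    · simpa [w] using hw
    · intro x _ hx
      by_cases hwx : x = β ∨ ∃ j ∈ S, f j = x
      · obtain ⟨j, hj, rfl⟩ := hwx.resolve_left hx
        rw [hG.apply_single_eq_zero (hf j hj), zero_mul]
      · simp [w, hwx]
    · simp
  · intro T _ hT
    by_cases hTS : T ⊆ S
    · have hpw : T.piecewise (fun i => if i ∈ S then Matrix.single (a i) (f i) (-c i) else 0)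
          (fun i => Matrix.single (a i) (b i) (c i)) = fun i => Matrix.single (a i)
            (T.piecewise f b i) (T.piecewise (fun i => -c i) c i) := by
        funext i
        by_cases hi : i ∈ T
        · simp [hi, hTS hi]
        · simp [hi]
      rw [hpw]
      refine Finset.sum_eq_zero fun x _ => ?_
      by_cases hwx : x = β ∨ ∃ j ∈ S, f j = x
      · refine mul_eq_zero_of_left (ih _ ?_ _ _ _ rfl) _
        rcases hwx with rfl | ⟨j, hj, rfl⟩
        · rw [← hs]
          refine Finset.card_lt_card ⟨fun i hi => ?_, fun hsub => ?_⟩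
          · rw [Finset.mem_filter] at hi
            by_cases hiT : i ∈ T
            · exact hTS hiT
            · rw [hbS]
              simpa [hiT] using hi.2
          · obtain ⟨i, hi⟩ := Finset.nonempty_iff_ne_empty.mpr hT
            have := hsub (hTS hi)
            simp [hi] at this
            exact hfβ i (hTS hi) this
        · refine lt_of_le_of_lt (Finset.card_le_one.mpr fun i hi i' hi' => ?_)
            (show 1 < s by omega)
          have key : ∀ i, T.piecewise f b i = f j → i = j := fun i hi => by
            by_cases hiT : i ∈ T
            · rw [Finset.piecewise_eq_of_mem _ _ _ hiT] at hi
              exact hfinj (hTS hiT) hj hi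
            · rw [Finset.piecewise_eq_of_notMem _ _ _ hiT] at hi
              exact absurd hi (hf j hj i)
          rw [Finset.mem_filter] at hi hi'
          rw [key i hi.2, key i' hi'.2]
      · simp [w, hwx]
    · obtain ⟨i, hiT, hiS⟩ := Finset.not_subset.mp hTS
      rw [G.map_coord_zero i (by simp [hiT, hiS]), zero_mulVec, Pi.zero_apply]
  · simp

end KillsOrthogonal

end

/-- The multilinear map `x ↦ B (x with the i-th argument removed) * x i`. -/
def MultilinearMap.mulSlot {N K : Type*} [Fintype N] [Field K] {d : ℕ} (i : Fin (d + 1))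
    (B : MultilinearMap ℤ (fun _ : Fin d => Matrix N N K) (Matrix N N K)) :
    MultilinearMap ℤ (fun _ : Fin (d + 1) => Matrix N N K) (Matrix N N K) :=
  LinearMap.uncurryMid (M := fun _ : Fin (d + 1) => Matrix N N K) i
    { toFun := fun x => (LinearMap.mulRight ℤ x).compMultilinearMap B
      map_add' := fun x y => by
        ext z
        simp [mul_add]
      map_smul' := fun c x => by
        ext z
        simp }

theorem MultilinearMap.mulSlot_apply {N K : Type*} [Fintype N] [Field K] {d : ℕ} (i : Fin (d + 1))
    (B : MultilinearMap ℤ (fun _ : Fin d => Matrix N N K) (Matrix N N K))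
    (x : Fin (d + 1) → Matrix N N K) : B.mulSlot i x = B (i.removeNth x) * x i := rfl

theorem IsPolarCommuting.exists_sub_smul_one {N K : Type*} [Fintype N] [DecidableEq N] [Field K]
    {e : ℕ} {G : MultilinearMap ℤ (fun _ : Fin e => Matrix N N K) (Matrix N N K)}
    (he : e < Fintype.card N) (hG : IsPolarCommuting G) :
    ∃ μ : MultilinearMap ℤ (fun _ : Fin e => Matrix N N K) K,
      KillsOrthogonal (G - ((LinearMap.toSpanSingleton K (Matrix N N K) 1).restrictScalars
        ℤ).compMultilinearMap μ) := by
  choose β hβ using fun b : Fin e → N => exists_forall_ne he b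
  obtain ⟨μ, hμ⟩ := exists_multilinearMap_single fun a b : Fin e → N =>
    (Matrix.entryLinearMap ℤ K (β b) (β b)).compMultilinearMap
      (G.compLinearMap fun i => Matrix.singleLinearMap ℤ (a i) (b i))
  refine ⟨μ, IsPolarCommuting.killsOrthogonal he ?_ fun a b c => ⟨β b, hβ b, ?_⟩⟩
  · intro α w y hα hw p q
    have h := hG α w y hα hw p q
    by_cases hp : α = p
    · subst hp
      rw [if_pos rfl] at h ⊢
      simp [sub_mulVec, ← h, sub_mul, smul_mulVec]
    · rw [if_neg hp] at h ⊢
      simpa [hp] using h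
  · simp [hμ]

theorem KillsOrthogonal.exists_mulSlot {N K : Type*} [Fintype N] [DecidableEq N] [Field K] {d : ℕ}
    {G : MultilinearMap ℤ (fun _ : Fin (d + 1) => Matrix N N K) (Matrix N N K)}
    (hd : d + 1 < Fintype.card N) (hG : KillsOrthogonal G) :
    ∃ B : Fin (d + 1) → MultilinearMap ℤ (fun _ : Fin d => Matrix N N K) (Matrix N N K),
      ∀ x, G x = ∑ i, B i (i.removeNth x) * x i := by
  choose β hβ using fun b : Fin d → N => exists_forall_ne (Nat.lt_of_succ_lt hd) b
  have hB : ∀ i : Fin (d + 1), ∃ B : MultilinearMap ℤ (fun _ : Fin d => Matrix N N K)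
      (Matrix N N K), ∀ (a b : Fin d → N) (c : Fin d → K),
      B (fun l => Matrix.single (a l) (b l) (c l)) =
        ∑ j, G (i.insertNth (Matrix.single j (β b) 1)
          fun l => Matrix.single (a l) (b l) (c l)) * Matrix.single (β b) j 1 := fun i => by
    obtain ⟨B, hB⟩ := exists_multilinearMap_single fun a b : Fin d → N =>
      ∑ j, (LinearMap.mulRight ℤ (Matrix.single (β b) j (1 : K))).compMultilinearMap
        ((G.curryMid i (Matrix.single j (β b) 1)).compLinearMap
          fun l => Matrix.singleLinearMap ℤ (a l) (b l))
    refine ⟨B, fun a b c => ?_⟩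
    rw [hB, _root_.sum_apply]
    rfl
  choose B hB using hB
  refine ⟨B, fun x => ?_⟩
  have hΓ : KillsOrthogonal (G - ∑ i, (B i).mulSlot i) := by
    intro a v w hw
    rw [_root_.sub_apply, _root_.sum_apply, sub_mulVec, hG a v w hw, sum_mulVec, zero_sub,
      neg_eq_zero]
    refine Finset.sum_eq_zero fun i _ => ?_
    rw [MultilinearMap.mulSlot_apply, ← mulVec_mulVec, vecMulVec_mulVec, hw]
    simp
  have h := hΓ.eq_zero hd (fun a b c i hi r => ?_) x
  · rw [_root_.sub_apply, _root_.sum_apply, sub_eq_zero] at h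
    exact h
  · rw [_root_.sub_apply, _root_.sum_apply, Matrix.sub_apply, Matrix.sum_apply,
      Finset.sum_eq_single i, sub_eq_zero]
    · rw [hG.apply_single hd hi (β := β (i.removeNth b)) (fun j hj => by
        obtain ⟨l, rfl⟩ := Fin.exists_succAbove_eq hj
        exact hβ (i.removeNth b) l), MultilinearMap.mulSlot_apply]
      have h1 := hB i (i.removeNth a) (i.removeNth b) (i.removeNth c)
      have h2 : (i.removeNth fun j => Matrix.single (a j) (b j) (c j)) =
        fun l => Matrix.single (i.removeNth a l) (i.removeNth b l) (i.removeNth c l) := rfl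
      rw [h2, h1, Finset.sum_mul, Matrix.sum_apply, Finset.sum_eq_single (a i)]
      · have h3 : i.insertNth (Matrix.single (a i) (β (i.removeNth b)) 1)
            (i.removeNth fun j => Matrix.single (a j) (b j) (c j)) =
            fun j => Matrix.single (a j) (Function.update b i (β (i.removeNth b)) j)
              (Function.update c i 1 j) := by
          rw [Fin.insertNth_removeNth]
          funext j
          by_cases hj : j = i
          · subst hj
            simp
          · simp [hj]
        rw [← h2, h3, mul_assoc, single_mul_single_same]
        simp [mul_comm]
      · intro j _ hj
        rw [mul_assoc, single_mul_single_of_ne _ _ _ _ hj]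
        simp
      · simp
    · intro j _ hj
      rw [MultilinearMap.mulSlot_apply]
      simp only [single_eq_vecMulVec_single_one, mul_vecMulVec, vecMulVec_apply,
        Pi.single_eq_of_ne (hi j hj).symm, mul_zero]
    · exact fun h => absurd (Finset.mem_univ i) h

theorem IsPolarCommuting.exists_trace_eq {N K : Type*} [Fintype N] [DecidableEq N] [Field K]
    {d : ℕ} {G : MultilinearMap ℤ (fun _ : Fin (d + 1) => Matrix N N K) (Matrix N N K)}
    (hd : d + 1 < Fintype.card N) (hG : IsPolarCommuting G) :
    ∃ (μ : MultilinearMap ℤ (fun _ : Fin (d + 1) => Matrix N N K) K)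
      (H : MultilinearMap ℤ (fun _ : Fin d => Matrix N N K) (Matrix N N K)),
      ∀ x, G (fun _ => x) = H (fun _ => x) * x + μ (fun _ => x) • 1 := by
  obtain ⟨μ, hμ⟩ := hG.exists_sub_smul_one hd
  obtain ⟨B, hB⟩ := hμ.exists_mulSlot hd
  refine ⟨μ, ∑ i, B i, fun x => ?_⟩
  have h := hB fun _ => x
  rw [_root_.sub_apply, sub_eq_iff_eq_add] at h
  rw [h, _root_.sum_apply, Finset.sum_mul]
  rfl

/-- The trace of a multilinear map commuting everywhere is a polynomial in `x` with coefficients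
that are traces of multilinear forms. -/
theorem exists_trace_eq_sum_smul_pow {N K : Type*} [Fintype N] [DecidableEq N] [Field K] {m : ℕ}
    (hshift : ∀ w : K, ∃ α : K, HasShifts (m + 2) (α * w) ∧ HasShifts (m + 2) ((1 - α) * w))
    (hm : ∀ e : ℕ, 0 < e → e ≤ m + 1 → (e : K) ≠ 0) (hmN : m + 1 ≤ Fintype.card N)
    {d : ℕ} (hd : d ≤ m) (G : MultilinearMap ℤ (fun _ : Fin d => Matrix N N K) (Matrix N N K))
    (hG : ∀ x : Matrix N N K, G (fun _ => x) * x - x * G (fun _ => x) = 0) :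
    ∃ T : (i : ℕ) → MultilinearMap ℤ (fun _ : Fin i => Matrix N N K) K,
      ∀ x, G (fun _ => x) = ∑ i ∈ Finset.range (d + 1), T i (fun _ => x) • x ^ (d - i) := by
  induction d with
  | zero =>
    have hc : G (fun _ => 0) ∈ Set.range (Matrix.scalar N) := by
      rw [Matrix.mem_range_scalar_iff_commute_single']
      intro i j
      have h := hG (Matrix.single i j 1)
      rw [Subsingleton.elim (fun _ => Matrix.single i j 1) (fun _ : Fin 0 => 0)] at h
      exact (sub_eq_zero.mp h).symm
    obtain ⟨c, hc⟩ := hc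
    refine ⟨fun i => if h : i = 0 then h ▸ MultilinearMap.constOfIsEmpty ℤ _ c else 0, fun x => ?_⟩
    rw [Subsingleton.elim (fun _ => x) (fun _ : Fin 0 => 0), ← hc]
    simp [Matrix.smul_one_eq_diagonal]
  | succ d ih =>
    have hP := isPolarCommuting_sum_perm G (sum_perm_commutator_eq_zero hshift hm le_rfl hmN hd G
      fun y _ => hG y)
    obtain ⟨μ, H, hH⟩ := hP.exists_trace_eq (by omega)
    have hf : ((d + 1).factorial : K) ≠ 0 := factorial_ne_zero_of_le hm (by omega)
    have htr : ∀ x, ((d + 1).factorial : K) • G (fun _ => x) =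
        H (fun _ => x) * x + μ (fun _ => x) • 1 := fun x => by
      rw [← hH, _root_.sum_apply, Nat.cast_smul_eq_nsmul]
      simp [MultilinearMap.domDomCongr_apply, Fintype.card_perm]
    have hHcomm : ∀ x, H (fun _ => x) * x - x * H (fun _ => x) = 0 := by
      refine commute_trace_of_rank_eq hshift hm hmN le_rfl (by omega) H fun y hy => ?_
      have hu : IsUnit y := by
        rw [← Matrix.linearIndependent_rows_iff_isUnit,
          linearIndependent_iff_card_eq_finrank_span, ← hy, Matrix.rank_eq_finrank_span_row]
        rfl
      have h : (((d + 1).factorial : K) • G (fun _ => y)) * y =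
          y * (((d + 1).factorial : K) • G (fun _ => y)) := by
        rw [smul_mul_assoc, mul_smul_comm, sub_eq_zero.mp (hG y)]
      rw [htr, add_mul, mul_add, smul_mul_assoc, one_mul, mul_smul_comm, mul_one,
        add_left_inj, ← mul_assoc] at h
      rw [hu.mul_right_cancel h, sub_self]
    obtain ⟨T, hT⟩ := ih (by omega) H hHcomm
    refine ⟨fun i => (LinearMap.mulLeft ℤ ((d + 1).factorial : K)⁻¹).compMultilinearMap
      (Function.update T (d + 1) μ i), fun x => ?_⟩
    rw [Finset.sum_range_succ, eq_comm, ← inv_smul_smul₀ hf (G fun _ => x), htr, hT,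
      Finset.sum_mul, smul_add, Finset.smul_sum]
    congr 1
    · refine Finset.sum_congr rfl fun i hi => ?_
      have hi' : i ≤ d := by
        rw [Finset.mem_range] at hi
        omega
      have hne : i ≠ d + 1 := by omega
      beta_reduce
      rw [Function.update_of_ne hne, smul_mul_assoc, ← pow_succ, smul_smul, Nat.succ_sub hi']
      rfl
    · beta_reduce
      rw [Function.update_self, Nat.sub_self, pow_zero, smul_smul]
      rfl

end

/-- If `G` is a symmetric `m`-additive map whose trace commutes on all
rank-`k` matrices (`m + 1 ≤ k ≤ n`), then the trace of `G` has the form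
`G(x,…,x) = μ₀ • x^m + Σ_{i=1}^{m} μ_i(x) • x^{m-i}`, where `μ₀ ∈ Z` and each
`μ_i : M_n(K) → Z` is the trace of an `i`-additive map into the center `Z = K • I`. -/
theorem stmt_12 (K : Type*) [Field K] (m n : ℕ) (hm : 1 < m) (hn : m + 1 ≤ n)
    (hchar : ringChar K = 0 ∨ m + 1 < ringChar K)
    (hcard : ((m + 4 : ℕ) : Cardinal) ≤ Cardinal.mk K)
    (k : ℕ) (hk1 : m + 1 ≤ k) (hkn : k ≤ n)
    (G : (Fin m → Matrix (Fin n) (Fin n) K) → Matrix (Fin n) (Fin n) K)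
    (hadd : ∀ (x : Fin m → Matrix (Fin n) (Fin n) K) (r : Fin m)
      (a b : Matrix (Fin n) (Fin n) K),
      G (Function.update x r (a + b)) = G (Function.update x r a) + G (Function.update x r b))
    (hsymm : ∀ (σ : Equiv.Perm (Fin m)) (x : Fin m → Matrix (Fin n) (Fin n) K),
      G (x ∘ σ) = G x)
    (hcomm : ∀ x : Matrix (Fin n) (Fin n) K, x.rank = k →
      G (fun _ => x) * x - x * G (fun _ => x) = 0) :
    ∃ (μ0 : K) (μ : Fin m → Matrix (Fin n) (Fin n) K → K),
      (∀ i : Fin m, ∃ T : (Fin ((i : ℕ) + 1) → Matrix (Fin n) (Fin n) K) → K,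
        MultiAdditive T ∧ ∀ x, μ i x = T (fun _ => x)) ∧
      ∀ x : Matrix (Fin n) (Fin n) K,
        G (fun _ => x) = μ0 • x ^ m + ∑ i : Fin m, μ i x • x ^ (m - ((i : ℕ) + 1)) := by
  have hchar' : ∀ e : ℕ, 0 < e → e ≤ m + 1 → (e : K) ≠ 0 := fun e he hem h => by
    have hdvd := (ringChar.spec K e).mp h
    rcases hchar with h0 | hp
    · rw [h0, zero_dvd_iff] at hdvd
      omega
    · have := Nat.le_of_dvd he hdvd
      omega
  have hshift := exists_hasShifts_split hchar hcard
  let G' : MultilinearMap ℤ (fun _ : Fin m => Matrix (Fin n) (Fin n) K)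
      (Matrix (Fin n) (Fin n) K) := .mk' G hadd fun x i c y =>
    map_zsmul (AddMonoidHom.mk' (fun y => G (Function.update x i y)) (hadd x i)) c y
  have hkN : k ≤ Fintype.card (Fin n) := by simpa using hkn
  have hcomm' := commute_trace_of_rank_eq hshift hchar' hk1 hkN le_rfl G' hcomm
  obtain ⟨T, hT⟩ := exists_trace_eq_sum_smul_pow hshift hchar' (by simpa using hn) le_rfl G' hcomm'
  refine ⟨T 0 ![], fun i x => T (i + 1) fun _ => x, fun i => ⟨T (i + 1), ?_, fun x => rfl⟩,
    fun x => ?_⟩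
  · exact fun x r a b => (T (i + 1)).map_update_add x r a b
  · refine (hT x).trans ?_
    rw [Finset.sum_range_succ', add_comm, Fin.sum_univ_eq_sum_range
      (fun i => T (i + 1) (fun _ => x) • x ^ (m - (i + 1))), Nat.sub_zero,
      Subsingleton.elim (fun _ => x) ![]]
end

section
/- Let K be a field and let m, n be natural numbers with n ≥ m + 1 and m > 1. Let M_n(K) be the ring of n × n matrices over K with center Z = K·I. Assume char K = 0 or char K > m + 1, and that K contains at least m + 4 elements. Let G : M_n(K)^m → M_n(K) be a symmetric m-additive map such that [G(x, …, x), x] = 0 for every invertible matrix x ∈ M_n(K). Then there exist μ_0 ∈ Z and maps μ_i : M_n(K) → Z for i ∈ {1, …, m}, such that each μ_i is the trace of an i-additive map into Z, and G(x, …, x) = μ_0·x^m + μ_1(x)·x^{m−1} + … + μ_{m−1}(x)·x + μ_m(x) for each x ∈ M_n(K). -/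
section Polarization

variable {R : Type*} [Ring R]

/-- Full polarization: if the trace of a multilinear map vanishes, so does its symmetrization. -/
theorem MultilinearMap.sum_perm_eq_zero_of_diag_eq_zero {ι M A : Type*} [Fintype ι] [DecidableEq ι]
    [AddCommGroup M] [AddCommGroup A] (W : MultilinearMap ℤ (fun _ : ι => M) A)
    (hW : ∀ x, W (fun _ => x) = 0) (x : ι → M) :
    ∑ σ : Equiv.Perm ι, W (fun i => x (σ i)) = 0 := by
  have key : ∑ S : Finset ι, (-1 : ℤ) ^ S.card • W (fun _ => ∑ j ∈ Sᶜ, x j) = 0 := by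
    simp [hW]
  have expand : ∀ S : Finset ι, W (fun _ => ∑ j ∈ Sᶜ, x j) =
      ∑ r : ι → ι, if S ⊆ (Finset.univ.image r)ᶜ then W (fun i => x (r i)) else 0 := by
    intro S
    rw [W.map_sum_finset (fun _ j => x j) (fun _ => Sᶜ), ← Finset.sum_filter]
    refine Finset.sum_congr ?_ fun _ _ => rfl
    ext r
    simp only [Fintype.mem_piFinset, Finset.mem_compl, Finset.mem_filter, Finset.mem_univ,
      true_and, Finset.subset_iff, Finset.mem_image, not_exists]
    exact ⟨fun h j hj i hi => h i (hi ▸ hj), fun h i hi => h hi i rfl⟩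
  simp only [expand, Finset.smul_sum] at key
  rw [Finset.sum_comm] at key
  have inner : ∀ r : ι → ι, (∑ S : Finset ι, (-1 : ℤ) ^ S.card •
      (if S ⊆ (Finset.univ.image r)ᶜ then W (fun i => x (r i)) else 0)) =
      if Function.Bijective r then W (fun i => x (r i)) else 0 := by
    intro r
    simp only [smul_ite, smul_zero]
    rw [← Finset.sum_filter, ← Finset.sum_smul]
    have : (Finset.univ.filter fun S : Finset ι => S ⊆ (Finset.univ.image r)ᶜ) =
        ((Finset.univ.image r)ᶜ).powerset := by
      ext; simp
    rw [this, Finset.sum_powerset_neg_one_pow_card]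
    have h2 : (Finset.univ.image r)ᶜ = ∅ ↔ Function.Bijective r := by
      rw [← Finite.surjective_iff_bijective]
      simp [Finset.eq_univ_iff_forall, Function.Surjective]
    simp only [h2, ite_smul, one_smul, zero_smul]
  simp only [inner] at key
  rw [← Finset.sum_filter] at key
  rw [← key]
  refine Finset.sum_bij' (fun σ _ => ⇑σ)
    (fun r hr => Equiv.ofBijective r (Finset.mem_filter.1 hr).2) ?_ ?_ ?_ ?_ ?_
  · intro σ _; simp
  · intros; simp
  · intro σ _; ext; simp
  · intros; rfl
  · intros; rfl

/-- The multilinear map `(x₀, …, x_m) ↦ [G(x₁, …, x_m), x₀]`. -/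
def MultilinearMap.commutator {m : ℕ} (G : MultilinearMap ℤ (fun _ : Fin m => R) R) :
    MultilinearMap ℤ (fun _ : Fin (m + 1) => R) R :=
  LinearMap.uncurryLeft (M := fun _ => R)
    { toFun := fun a => (LinearMap.mulRight ℤ a - LinearMap.mulLeft ℤ a).compMultilinearMap G
      map_add' := fun a b => by ext; simp [mul_add, add_mul]; abel
      map_smul' := fun c a => by ext; simp [sub_mul, ← mul_assoc, (Int.cast_commute c _).eq] }

theorem MultilinearMap.commutator_apply {m : ℕ} (G : MultilinearMap ℤ (fun _ : Fin m => R) R)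
    (x : Fin (m + 1) → R) :
    G.commutator x = G (fun i => x i.succ) * x 0 - x 0 * G (fun i => x i.succ) := rfl

/-- The symmetrization of a multilinear map. -/
def MultilinearMap.symmetrization {m : ℕ} (G : MultilinearMap ℤ (fun _ : Fin m => R) R) :
    MultilinearMap ℤ (fun _ : Fin m => R) R :=
  ∑ σ : Equiv.Perm (Fin m), G.domDomCongr σ

theorem MultilinearMap.symmetrization_apply {m : ℕ}
    (G : MultilinearMap ℤ (fun _ : Fin m => R) R) (x : Fin m → R) :
    G.symmetrization x = ∑ σ : Equiv.Perm (Fin m), G (fun i => x (σ i)) := by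
  simp [symmetrization]

theorem MultilinearMap.symmetrization_commutator_eq_zero {m : ℕ}
    (G : MultilinearMap ℤ (fun _ : Fin m => R) R)
    (hG : ∀ x, G (fun _ => x) * x = x * G (fun _ => x)) (v : Fin m → R) (y : R) :
    (G.symmetrization v * y - y * G.symmetrization v) +
      ∑ k, (G.symmetrization (Function.update v k y) * v k -
        v k * G.symmetrization (Function.update v k y)) = 0 := by
  have h := G.commutator.sum_perm_eq_zero_of_diag_eq_zero
    (fun x => by rw [commutator_apply, hG, sub_self]) (Fin.cons y v)
  rw [← Equiv.Perm.decomposeFin.symm.sum_comp, Fintype.sum_prod_type] at h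
  simp only [commutator_apply, Equiv.Perm.decomposeFin_symm_apply_zero,
    Equiv.Perm.decomposeFin_symm_apply_succ, Fin.sum_univ_succ (n := m), Fin.cons_zero,
    Fin.cons_succ, Finset.sum_sub_distrib, Equiv.swap_self, Equiv.refl_apply, ← Finset.sum_mul,
    ← Finset.mul_sum, ← symmetrization_apply] at h
  rw [Finset.sum_sub_distrib, ← h]
  have e : ∀ k : Fin m, G.symmetrization (Function.update v k y) =
      ∑ σ : Equiv.Perm (Fin m),
        G (fun i => (Fin.cons y v : Fin (m + 1) → R) (Equiv.swap 0 k.succ (σ i).succ)) := by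
    intro k
    rw [symmetrization_apply]
    refine Finset.sum_congr rfl fun σ _ => congrArg G (funext fun i => ?_)
    by_cases hk : σ i = k
    · simp [hk]
    · rw [Equiv.swap_apply_of_ne_of_ne (Fin.succ_ne_zero _) (by simpa using hk)]
      simp [hk]
  simp only [e]

/-- The polarized commuting identity at arguments `x` and `x * t`, weighted by powers of `-t`: the
terms `G(…, y, …) * x` cancel in pairs. -/
theorem MultilinearMap.sum_twisted_mul_eq {m : ℕ} (G : MultilinearMap ℤ (fun _ : Fin m => R) R)
    (hG : ∀ (v : Fin m → R) (y : R), (G v * y - y * G v) +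
      ∑ k, (G (Function.update v k y) * v k - v k * G (Function.update v k y)) = 0) (x y t : R) :
    ∑ S : Finset (Fin m), G (fun i => x * if i ∈ S then 1 else t) * y * (-t) ^ S.card =
      y * ∑ S : Finset (Fin m), G (fun i => x * if i ∈ S then 1 else t) * (-t) ^ S.card +
      x * ∑ k, ∑ S : Finset (Fin m), (if k ∈ S then 1 else t) *
        G (Function.update (fun i => x * if i ∈ S then 1 else t) k y) * (-t) ^ S.card := by
  have cancel : ∀ k, ∑ S : Finset (Fin m),
      G (Function.update (fun i => x * if i ∈ S then 1 else t) k y) *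
        (x * if k ∈ S then 1 else t) * (-t) ^ S.card = 0 := by
    intro k
    rw [← Finset.sum_filter_add_sum_filter_not _ (fun S : Finset (Fin m) => k ∈ S),
      add_eq_zero_iff_eq_neg, ← Finset.sum_neg_distrib]
    refine Finset.sum_bij' (fun S _ => S.erase k) (fun S _ => insert k S) ?_ ?_ ?_ ?_ ?_
    · intros; simp
    · intros; simp
    · intro S hS; exact Finset.insert_erase (Finset.mem_filter.1 hS).2
    · intro S hS; exact Finset.erase_insert (Finset.mem_filter.1 hS).2
    · intro S hS
      have hk : k ∈ S := (Finset.mem_filter.1 hS).2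
      have hu : Function.update (fun i => x * if i ∈ S.erase k then 1 else t) k y =
          Function.update (fun i => x * if i ∈ S then 1 else t) k y := by
        ext i
        by_cases hi : i = k
        · subst hi; simp
        · simp [hi]
      rw [hu, ← Finset.card_erase_add_one hk, pow_succ']
      simp [hk, mul_assoc]
  have h := Finset.sum_congr (rfl : (Finset.univ : Finset (Finset (Fin m))) = Finset.univ)
    fun S _ => congrArg (· * (-t) ^ S.card) (hG (fun i => x * if i ∈ S then 1 else t) y)
  simp only [add_mul, sub_mul, Finset.sum_add_distrib, Finset.sum_sub_distrib, Finset.sum_mul,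
    zero_mul, Finset.sum_const_zero] at h
  rw [Finset.sum_comm (f := fun S k => _ * _ * _), Finset.sum_congr rfl fun k _ => cancel k] at h
  rw [Finset.sum_const_zero, zero_sub, Finset.sum_comm, ← sub_eq_add_neg, sub_eq_zero,
    sub_eq_iff_eq_add] at h
  rw [h, add_comm]
  simp only [Finset.mul_sum, mul_assoc]

end Polarization

section Matrix

variable {K : Type*} [Field K] {n : ℕ}

open Fin.CommRing in
/-- A singular diagonal matrix plus a nonzero multiple of the cyclic shift is invertible. -/
theorem Matrix.isUnit_diagonal_add_smul_shift [NeZero n] (d : Fin n → K) {i₀ : Fin n}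
    (hd : d i₀ = 0) {s : K} (hs : s ≠ 0) :
    IsUnit (diagonal d +
      s • (of fun i j => if j = i + 1 then 1 else 0 : Matrix (Fin n) (Fin n) K)) := by
  rw [← Matrix.mulVec_injective_iff_isUnit, ← Matrix.coe_mulVecLin, ← LinearMap.ker_eq_bot,
    LinearMap.ker_eq_bot']
  intro v hv
  have h : ∀ i, d i * v i + s * v (i + 1) = 0 := by
    intro i
    have := congrFun hv i
    rw [mulVecLin_apply, add_mulVec, smul_mulVec, Pi.add_apply, mulVec_diagonal] at this
    simpa [mulVec, dotProduct] using this
  have hk : ∀ k : ℕ, v (i₀ + 1 + (k : Fin n)) = 0 := by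
    intro k
    induction k with
    | zero => simpa [hd, hs] using h i₀
    | succ k ih =>
      have := h (i₀ + 1 + (k : Fin n))
      rw [ih, mul_zero, zero_add] at this
      rw [Nat.cast_succ, ← add_assoc]
      exact (mul_eq_zero.1 this).resolve_left hs
  ext i
  have := hk (i - (i₀ + 1) : Fin n).val
  rwa [Fin.cast_val_eq_self, add_sub_cancel] at this

/-- For a singular `x` there is an invertible `y` such that `x + s • y` is invertible for all
`s ≠ 0`. -/
theorem Matrix.exists_isUnit_forall_isUnit_add_smul (x : Matrix (Fin n) (Fin n) K)
    (hx : ¬ IsUnit x) :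
    ∃ y : Matrix (Fin n) (Fin n) K, IsUnit y ∧ ∀ s : K, s ≠ 0 → IsUnit (x + s • y) := by
  obtain ⟨L, L', D, h⟩ := Matrix.Pivot.exists_list_transvec_mul_diagonal_mul_list_transvec x
  have hprod : ∀ L : List (TransvectionStruct (Fin n) K),
      IsUnit (L.map TransvectionStruct.toMatrix).prod := fun L => by
    rw [Matrix.isUnit_iff_isUnit_det]; simp
  have hP := hprod L
  have hQ := hprod L'
  set P := (L.map TransvectionStruct.toMatrix).prod
  set Q := (L'.map TransvectionStruct.toMatrix).prod
  have hD : ∃ i₀, D i₀ = 0 := by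
    by_contra! hD
    refine hx (h ▸ (hP.mul ?_).mul hQ)
    rw [Matrix.isUnit_iff_isUnit_det, det_diagonal, isUnit_iff_ne_zero]
    exact Finset.prod_ne_zero_iff.2 fun i _ => hD i
  obtain ⟨i₀, hi₀⟩ := hD
  have : NeZero n := ⟨by rintro rfl; exact i₀.elim0⟩
  let C : Matrix (Fin n) (Fin n) K := of fun i j => if j = i + 1 then 1 else 0
  refine ⟨P * C * Q, (hP.mul ?_).mul hQ, fun s hs => ?_⟩
  · simpa using isUnit_diagonal_add_smul_shift (fun _ => (0 : K)) (i₀ := i₀) rfl one_ne_zero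
  · have e : x + s • (P * C * Q) = P * (diagonal D + s • C) * Q := by
      rw [h, mul_add, add_mul, mul_smul_comm, smul_mul_assoc]
    rw [e]
    exact (hP.mul (isUnit_diagonal_add_smul_shift D hi₀ hs)).mul hQ

/-- A homogeneous polynomial map of degree `N` vanishing at `y` and at `x + j • y` for
`1 ≤ j ≤ N` vanishes at `x`. -/
theorem MultilinearMap.diag_eq_zero_of_add_nsmul {M : Type*} [AddCommGroup M] {N : ℕ}
    (hK : ∀ j : ℕ, 1 ≤ j → j ≤ N → (j : K) ≠ 0) (W : MultilinearMap ℤ (fun _ : Fin N => M) K)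
    (x y : M) (hy : W (fun _ => y) = 0)
    (h : ∀ j : ℕ, 1 ≤ j → j ≤ N → W (fun _ => x + j • y) = 0) : W (fun _ => x) = 0 := by
  classical
  open Polynomial in
  let p : K[X] := ∑ S : Finset (Fin N), C (W (S.piecewise (fun _ => x) fun _ => y)) * X ^ Sᶜ.card
  have heval : ∀ j : ℕ, p.eval (j : K) = W (fun _ => x + j • y) := by
    intro j
    have e := W.map_add_univ (fun _ => x) (fun _ => j • y)
    rw [show (fun _ : Fin N => x + j • y) = (fun _ => x) + (fun _ => j • y) from rfl, e,
      Polynomial.eval_finsetSum]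
    refine Finset.sum_congr rfl fun S _ => ?_
    have e2 := W.map_piecewise_smul (fun _ => (j : ℤ)) (S.piecewise (fun _ => x) fun _ => y) Sᶜ
    have e3 : Sᶜ.piecewise (fun i => (j : ℤ) • S.piecewise (fun _ => x) (fun _ => y) i)
        (S.piecewise (fun _ => x) fun _ => y) = S.piecewise (fun _ => x) fun _ => j • y := by
      ext i
      by_cases hi : i ∈ S <;> simp [hi]
    rw [e3] at e2
    rw [e2, Finset.prod_const, zsmul_eq_mul, Polynomial.eval_mul, Polynomial.eval_C,
      Polynomial.eval_pow, Polynomial.eval_X, mul_comm, Int.cast_pow, Int.cast_natCast]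
  have hdeg : p.degree < N := by
    refine (Polynomial.degree_lt_iff_coeff_zero _ _).2 fun d hd => ?_
    simp only [p, Polynomial.finsetSum_coeff, Polynomial.coeff_C_mul, Polynomial.coeff_X_pow]
    refine Finset.sum_eq_zero fun S _ => ?_
    by_cases hS : S = ∅
    · subst hS
      rw [Finset.piecewise_empty, hy, zero_mul]
    · have : Sᶜ.card < N := by
        have h1 := Finset.card_pos.2 (Finset.nonempty_iff_ne_empty.2 hS)
        have h2 := S.card_add_card_compl
        rw [Fintype.card_fin] at h2
        omega
      rw [if_neg (by omega), mul_zero]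
  have hinj : Set.InjOn (fun j : ℕ => (j : K)) (Finset.Icc 1 N : Finset ℕ) := by
    have aux : ∀ i j : ℕ, 1 ≤ i → j ≤ N → i < j → (i : K) ≠ j := fun i j hi hj hij he => by
      refine hK (j - i) (by omega) (by omega) ?_
      rw [Nat.cast_sub hij.le, he, sub_self]
    intro i hi j hj hij
    simp only [Finset.coe_Icc, Set.mem_Icc] at hi hj
    rcases lt_trichotomy i j with hlt | heq | hlt
    · exact (aux i j hi.1 hj.2 hlt hij).elim
    · exact heq
    · exact (aux j i hj.1 hi.2 hlt hij.symm).elim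
  have hp : p = 0 := by
    refine Polynomial.eq_zero_of_degree_lt_of_eval_index_eq_zero (s := Finset.Icc 1 N)
      (v := fun j : ℕ => (j : K)) hinj (by simpa using hdeg) fun j hj => ?_
    rw [heval]
    exact h j (Finset.mem_Icc.1 hj).1 (Finset.mem_Icc.1 hj).2
  simpa [hp] using (heval 0).symm

/-- A homogeneous polynomial map on matrices vanishing at invertible matrices vanishes. -/
theorem MultilinearMap.diag_eq_zero_of_isUnit {N : ℕ}
    (hK : ∀ j : ℕ, 1 ≤ j → j ≤ N → (j : K) ≠ 0)
    (W : MultilinearMap ℤ (fun _ : Fin N => Matrix (Fin n) (Fin n) K) (Matrix (Fin n) (Fin n) K))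
    (hW : ∀ x, IsUnit x → W (fun _ => x) = 0) (x : Matrix (Fin n) (Fin n) K) :
    W (fun _ => x) = 0 := by
  by_cases hx : IsUnit x
  · exact hW x hx
  obtain ⟨y, hy, hxy⟩ := Matrix.exists_isUnit_forall_isUnit_add_smul x hx
  ext a b
  refine diag_eq_zero_of_add_nsmul hK
    ((Matrix.entryLinearMap ℤ K a b).compMultilinearMap W) x y ?_ fun j h1 h2 => ?_
  · simp [hW y hy]
  · have hu := hxy j (hK j h1 h2)
    rw [Nat.cast_smul_eq_nsmul] at hu
    rw [LinearMap.compMultilinearMap_apply, hW _ hu]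
    rfl

end Matrix

section Shift

variable {K : Type*} [Field K] {n : ℕ}

/-- The matrix-unit expression of the entry functional `B ↦ B a b`. -/
theorem Matrix.sum_single_mul_mul_single (B : Matrix (Fin n) (Fin n) K) (a b : Fin n) :
    ∑ l, single l a (1 : K) * B * single b l 1 = B a b • 1 := by
  ext i j
  simp [Matrix.sum_apply, single_mul_mul_single, Matrix.one_apply, single_apply, ite_and]

/-- The nilpotent Jordan block. -/
def Matrix.jordanShift (K : Type*) [Field K] (n : ℕ) : Matrix (Fin n) (Fin n) K :=
  of fun i j => if (j : ℕ) = i + 1 then 1 else 0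

theorem Matrix.jordanShift_pow_apply (u : ℕ) (i j : Fin n) :
    (jordanShift K n ^ u) i j = if (j : ℕ) = i + u then 1 else 0 := by
  induction u generalizing i with
  | zero => simp [Matrix.one_apply, Fin.ext_iff, eq_comm]
  | succ u ih =>
    rw [pow_succ', Matrix.mul_apply]
    simp only [ih]
    simp only [jordanShift, of_apply, ite_mul, one_mul, zero_mul]
    by_cases hi : (i : ℕ) + 1 < n
    · rw [Finset.sum_eq_single ⟨i + 1, hi⟩]
      · simp [add_assoc, add_comm 1 u]
      · intro k _ hk
        rw [if_neg fun h => hk (Fin.ext h)]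
      · simp
    · rw [Finset.sum_eq_zero, if_neg (by omega)]
      intro k _
      rw [if_neg (by omega)]

end Shift

section Main

variable {K : Type*} [Field K] {n : ℕ}

open Matrix in
/-- A commuting trace `G(x, …, x)` is a scalar plus a left multiple of `x`. -/
theorem MultilinearMap.exists_diag_eq_smul_one_add_mul {m : ℕ} (hn : m + 1 < n)
    (hK : ∀ j : ℕ, 1 ≤ j → j ≤ m + 1 → (j : K) ≠ 0)
    (G : MultilinearMap ℤ (fun _ : Fin (m + 1) => Matrix (Fin n) (Fin n) K)
      (Matrix (Fin n) (Fin n) K))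
    (hG : ∀ x, G (fun _ => x) * x = x * G (fun _ => x)) :
    ∃ (c : MultilinearMap ℤ (fun _ : Fin (m + 1) => Matrix (Fin n) (Fin n) K) K)
      (P : MultilinearMap ℤ (fun _ : Fin m => Matrix (Fin n) (Fin n) K)
        (Matrix (Fin n) (Fin n) K)),
      ∀ x, G (fun _ => x) = c (fun _ => x) • 1 + x * P (fun _ => x) := by
  set H := G.symmetrization with hH
  set t := jordanShift K n
  let a : Fin n := ⟨0, by omega⟩
  let b : Fin n := ⟨m + 1, hn⟩
  let e (S : Finset (Fin (m + 1))) (i : Fin (m + 1)) : Matrix (Fin n) (Fin n) K :=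
    if i ∈ S then 1 else t
  let c : MultilinearMap ℤ (fun _ : Fin (m + 1) => Matrix (Fin n) (Fin n) K) K :=
    (entryLinearMap ℤ K a b).compMultilinearMap (∑ S : Finset (Fin (m + 1)),
      (LinearMap.mulRight ℤ ((-t) ^ S.card)).compMultilinearMap
        (H.compLinearMap fun i => LinearMap.mulRight ℤ (e S i)))
  let P : MultilinearMap ℤ (fun _ : Fin m => Matrix (Fin n) (Fin n) K)
      (Matrix (Fin n) (Fin n) K) :=
    ∑ l, ∑ k, ∑ S : Finset (Fin (m + 1)),
      (LinearMap.mulRight ℤ ((-t) ^ S.card * single b l 1) ∘ₗ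
        LinearMap.mulLeft ℤ (e S k)).compMultilinearMap
        ((H.curryMid k (single l a 1)).compLinearMap fun i =>
          LinearMap.mulRight ℤ (e S (k.succAbove i)))
  have hc : ∀ x, c (fun _ => x) =
      (∑ S : Finset (Fin (m + 1)), H (fun i => x * e S i) * (-t) ^ S.card) a b := by
    intro x
    simp [c, Matrix.sum_apply]
  have hP : ∀ x, P (fun _ => x) = ∑ l, ∑ k, ∑ S : Finset (Fin (m + 1)),
      e S k * H (Function.update (fun i => x * e S i) k (single l a 1)) * (-t) ^ S.card *
        single b l 1 := by
    intro x
    have hu : ∀ (k : Fin (m + 1)) (S : Finset (Fin (m + 1))) (y : Matrix (Fin n) (Fin n) K),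
        Function.update (fun i => x * e S i) k y =
          k.insertNth (α := fun _ => Matrix (Fin n) (Fin n) K) y
            (fun i => x * e S (k.succAbove i)) := by
      intro k S y
      exact (Fin.insertNth_removeNth k y (fun i => x * e S i)).symm
    simp only [hu]
    simp [P, mul_assoc]
  have hpow : ∀ k : ℕ, ((-t) ^ k) a b = if k = m + 1 then (-1) ^ (m + 1) else 0 := by
    intro k
    rw [← neg_one_smul K t, smul_pow, Matrix.smul_apply, jordanShift_pow_apply]
    by_cases hk : k = m + 1
    · simp [a, b, hk]
    · simp [a, b, hk, Ne.symm hk]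
  have key : ∀ x, (-1 : K) ^ (m + 1) • H (fun _ => x) =
      c (fun _ => x) • 1 + x * P (fun _ => x) := by
    intro x
    have h := Finset.sum_congr (rfl : (Finset.univ : Finset (Fin n)) = Finset.univ) fun l _ =>
      congrArg (· * single b l 1) (H.sum_twisted_mul_eq
        (G.symmetrization_commutator_eq_zero hG) x (single l a 1) t)
    simp only [add_mul, Finset.sum_add_distrib] at h
    rw [sum_single_mul_mul_single] at h
    rw [hc, hP]
    refine Eq.trans ?_ (h.trans ?_)
    · simp only [Finset.sum_mul]
      rw [Finset.sum_comm, Finset.sum_eq_single Finset.univ]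
      · simp only [mul_assoc, ← Finset.mul_sum]
        simp only [← mul_assoc]
        rw [sum_single_mul_mul_single, hpow, Finset.card_univ, Fintype.card_fin, if_pos rfl]
        simp
      · intro S _ hS
        simp only [mul_assoc, ← Finset.mul_sum]
        simp only [← mul_assoc]
        rw [sum_single_mul_mul_single, hpow, if_neg, zero_smul, mul_zero]
        rwa [ne_eq, ← Finset.card_eq_iff_eq_univ, Fintype.card_fin] at hS
      · simp
    · simp only [Finset.sum_mul, Finset.mul_sum, mul_assoc, e]
  have hdiag : ∀ x, H (fun _ => x) = ((m + 1).factorial : K) • G (fun _ => x) := by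
    intro x
    rw [hH, symmetrization_apply, Finset.sum_const, Finset.card_univ, Fintype.card_perm,
      Fintype.card_fin, Nat.cast_smul_eq_nsmul]
  have hf : ((m + 1).factorial : K) ≠ 0 := by
    rw [← Finset.prod_range_add_one_eq_factorial, Nat.cast_prod]
    exact Finset.prod_ne_zero_iff.2 fun j hj =>
      hK _ (by omega) (by have := Finset.mem_range.1 hj; omega)
  set s : K := (-1) ^ (m + 1) * (m + 1).factorial
  have hs : s ≠ 0 := mul_ne_zero (pow_ne_zero _ (neg_ne_zero.2 one_ne_zero)) hf
  refine ⟨s⁻¹ • c, s⁻¹ • P, fun x => ?_⟩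
  have := key x
  rw [hdiag, smul_smul] at this
  rw [_root_.smul_apply, _root_.smul_apply, mul_smul_comm, smul_assoc, ← smul_add, ← this,
    inv_smul_smul₀ hs]

/-- Commuting traces on `M_n(K)` have the standard form. -/
theorem MultilinearMap.exists_diag_eq_sum_smul_pow (m : ℕ) (hn : m < n)
    (hK : ∀ j : ℕ, 1 ≤ j → j ≤ m + 1 → (j : K) ≠ 0)
    (G : MultilinearMap ℤ (fun _ : Fin m => Matrix (Fin n) (Fin n) K)
      (Matrix (Fin n) (Fin n) K))
    (hG : ∀ x, IsUnit x → G (fun _ => x) * x - x * G (fun _ => x) = 0) :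
    ∃ c : ∀ i : ℕ, MultilinearMap ℤ (fun _ : Fin i => Matrix (Fin n) (Fin n) K) K,
      ∀ x, G (fun _ => x) = ∑ i ∈ Finset.range (m + 1), c i (fun _ => x) • x ^ (m - i) := by
  have hcomm : ∀ x, G (fun _ => x) * x = x * G (fun _ => x) := fun x =>
    sub_eq_zero.1 (diag_eq_zero_of_isUnit hK G.commutator hG x)
  induction m with
  | zero =>
    obtain ⟨r, hr⟩ := Matrix.mem_range_scalar_of_commute_single (M := G 0)
      fun i j _ => by
        have := hcomm (Matrix.single i j 1)
        rw [Subsingleton.elim (fun _ => Matrix.single i j 1) (0 : Fin 0 → _)] at this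
        exact this.symm
    refine ⟨fun i => Function.update (β := fun i : ℕ => MultilinearMap ℤ
      (fun _ : Fin i => Matrix (Fin n) (Fin n) K) K) 0 0 (constOfIsEmpty ℤ _ r) i, fun x => ?_⟩
    rw [Subsingleton.elim (fun _ => x) (0 : Fin 0 → _), ← hr]
    simp [Matrix.smul_one_eq_diagonal]
  | succ m ih =>
    obtain ⟨c, P, h⟩ := G.exists_diag_eq_smul_one_add_mul hn
      (fun j h1 h2 => hK j h1 (by omega)) hcomm
    have hP : ∀ x, IsUnit x → P (fun _ => x) * x - x * P (fun _ => x) = 0 := by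
      intro x hx
      have := hcomm x
      rw [h, add_mul, mul_add, smul_one_mul, mul_smul_comm, mul_one, add_right_inj,
        mul_assoc] at this
      exact sub_eq_zero.2 (hx.mul_left_cancel this)
    have hK' : ∀ j : ℕ, 1 ≤ j → j ≤ m + 1 → (j : K) ≠ 0 := fun j h1 h2 => hK j h1 (by omega)
    obtain ⟨d, hd⟩ := ih (by omega) hK' P hP fun x =>
      sub_eq_zero.1 (diag_eq_zero_of_isUnit hK' P.commutator hP x)
    refine ⟨Function.update d (m + 1) c, fun x => ?_⟩
    rw [Finset.sum_range_succ, Function.update_self, Nat.sub_self, pow_zero, h, hd, add_comm,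
      Finset.mul_sum]
    congr 1
    refine Finset.sum_congr rfl fun i hi => ?_
    have hi := Finset.mem_range.1 hi
    rw [Function.update_of_ne hi.ne, mul_smul_comm, ← pow_succ', Nat.succ_sub (by omega)]

end Main


/-- If `G` is a symmetric `m`-additive map whose trace commutes on all
invertible matrices, then the trace of `G` has the form
`G(x,…,x) = μ₀ • x^m + Σ_{i=1}^{m} μ_i(x) • x^{m-i}`, where `μ₀ ∈ Z` and each
`μ_i : M_n(K) → Z` is the trace of an `i`-additive map into the center `Z = K • I`. -/
theorem stmt_13 (K : Type*) [Field K] (m n : ℕ) (hm : 1 < m) (hn : m + 1 ≤ n)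
    (hchar : ringChar K = 0 ∨ m + 1 < ringChar K)
    (hcard : ((m + 4 : ℕ) : Cardinal) ≤ Cardinal.mk K)
    
    (G : (Fin m → Matrix (Fin n) (Fin n) K) → Matrix (Fin n) (Fin n) K)
    (hadd : ∀ (x : Fin m → Matrix (Fin n) (Fin n) K) (r : Fin m)
      (a b : Matrix (Fin n) (Fin n) K),
      G (Function.update x r (a + b)) = G (Function.update x r a) + G (Function.update x r b))
    (hsymm : ∀ (σ : Equiv.Perm (Fin m)) (x : Fin m → Matrix (Fin n) (Fin n) K),
      G (x ∘ σ) = G x)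
    (hcomm : ∀ x : Matrix (Fin n) (Fin n) K, IsUnit x →
      G (fun _ => x) * x - x * G (fun _ => x) = 0) :
    ∃ (μ0 : K) (μ : Fin m → Matrix (Fin n) (Fin n) K → K),
      (∀ i : Fin m, ∃ T : (Fin ((i : ℕ) + 1) → Matrix (Fin n) (Fin n) K) → K,
        MultiAdditive T ∧ ∀ x, μ i x = T (fun _ => x)) ∧
      ∀ x : Matrix (Fin n) (Fin n) K,
        G (fun _ => x) = μ0 • x ^ m + ∑ i : Fin m, μ i x • x ^ (m - ((i : ℕ) + 1)) := by
  have hK : ∀ j : ℕ, 1 ≤ j → j ≤ m + 1 → (j : K) ≠ 0 := by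
    intro j h1 h2 h0
    have hdvd := (ringChar.spec K j).1 h0
    rcases hchar with h | h
    · rw [h, zero_dvd_iff] at hdvd
      omega
    · have := Nat.le_of_dvd (by omega) hdvd
      omega
  let Gm : MultilinearMap ℤ (fun _ : Fin m => Matrix (Fin n) (Fin n) K)
      (Matrix (Fin n) (Fin n) K) := .mk' G hadd fun x r k a =>
    map_zsmul (AddMonoidHom.mk' (fun a => G (Function.update x r a)) (hadd x r)) k a
  obtain ⟨c, hc⟩ := Gm.exists_diag_eq_sum_smul_pow m hn hK hcomm
  refine ⟨c 0 (fun _ => 0), fun i x => c (i + 1) (fun _ => x),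
    fun i => ⟨c (i + 1), (c (i + 1)).map_update_add, fun _ => rfl⟩, fun x => ?_⟩
  have h := hc x
  rw [Finset.sum_range_succ', add_comm, Nat.sub_zero,
    Subsingleton.elim (fun _ : Fin 0 => x) (fun _ => 0)] at h
  rwa [Finset.sum_range (fun i => c (i + 1) (fun _ => x) • x ^ (m - (i + 1)))] at h
end

section
/- Let K be a field and let m, n be natural numbers with n ≥ m + 1 and m > 1. Let M_n(K) be the ring of n × n matrices over K with center Z = K·I. Assume char K = 0 or char K > m + 1, and that K contains at least m + 4 elements. Let G : M_n(K)^m → M_n(K) be a symmetric m-additive map such that [G(x, …, x), x] = 0 for every singular (non-invertible) matrix x ∈ M_n(K). Then there exist μ_0 ∈ Z and maps μ_i : M_n(K) → Z for i ∈ {1, …, m}, such that each μ_i is the trace of an i-additive map into Z, and G(x, …, x) = μ_0·x^m + μ_1(x)·x^{m−1} + … + μ_{m−1}(x)·x + μ_m(x) for each x ∈ M_n(K). -/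
section CommutingTrace

open Finset Matrix

/-- If a multilinear map vanishes on the constant tuple at every proper subsum of a family `R`,
then its value on the constant tuple at the full sum only involves tuples using each member of
the family. -/
theorem MultilinearMap.map_const_sum_eq_sum_surjective {k : ℕ} {ι M N : Type*} [Fintype ι]
    [DecidableEq ι] [AddCommGroup M] [AddCommGroup N]
    (f : MultilinearMap ℤ (fun _ : Fin k => M) N) (R : ι → M)
    (h : ∀ S : Finset ι, S ≠ univ → f (fun _ => ∑ i ∈ S, R i) = 0) :
    f (fun _ => ∑ i, R i) = ∑ g : Fin k → ι with univ.image g = univ, f (R ∘ g) := by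
  have expand : ∀ S : Finset ι, f (fun _ => ∑ i ∈ S, R i) =
      ∑ T ∈ S.powerset, ∑ g : Fin k → ι with univ.image g = T, f (R ∘ g) := by
    intro S
    rw [f.map_sum_finset (fun _ i => R i) (fun _ => S),
      ← Finset.sum_fiberwise_of_maps_to (t := S.powerset) (g := fun g => univ.image g)
        (fun g hg => by simpa [image_subset_iff] using hg)]
    refine sum_congr rfl fun T hT => sum_congr ?_ fun _ _ => rfl
    ext g
    simp only [mem_filter, mem_univ, true_and, Fintype.mem_piFinset, and_iff_right_iff_imp]
    rintro rfl i
    exact mem_powerset.1 hT (mem_image_of_mem g (mem_univ i))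
  have proper : ∀ S : Finset ι, S ≠ univ →
      ∑ g : Fin k → ι with univ.image g = S, f (R ∘ g) = 0 := by
    intro S
    induction S using Finset.strongInduction with
    | H S ih =>
      intro hS
      have := expand S
      rw [h S hS, ← sum_erase_add _ _ (mem_powerset_self S), sum_eq_zero, zero_add] at this
      · exact this.symm
      · intro T hT
        obtain ⟨hne, hT⟩ := mem_erase.1 hT
        have hss := (mem_powerset.1 hT).ssubset_of_ne hne
        exact ih T hss fun hu => hss.2 (hu ▸ subset_univ _)
  rw [expand, ← sum_erase_add _ _ (mem_powerset_self univ), sum_eq_zero, zero_add]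
  exact fun T hT => proper T (ne_of_mem_erase hT)

namespace MultilinearMap

variable {k : ℕ} {M M' N : Type*} [AddCommGroup M] [AddCommGroup M'] [AddCommGroup N]

/-- The multilinear map `x ↦ B (F (x 1, …, x k)) (x 0)`. -/
def consPair (F : MultilinearMap ℤ (fun _ : Fin k => M) M') (B : M' →ₗ[ℤ] M →ₗ[ℤ] N) :
    MultilinearMap ℤ (fun _ : Fin (k + 1) => M) N :=
  LinearMap.uncurryLeft (M := fun _ : Fin (k + 1) => M)
    { toFun z := (B.flip z).compMultilinearMap F
      map_add' _ _ := by ext; simp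
      map_smul' _ _ := by ext; simp }

theorem consPair_apply (F : MultilinearMap ℤ (fun _ : Fin k => M) M')
    (B : M' →ₗ[ℤ] M →ₗ[ℤ] N) (x : Fin (k + 1) → M) :
    F.consPair B x = B (F fun i => x i.succ) (x 0) := rfl

/-- The sum of a multilinear map over all permutations of its arguments. -/
def symmSum (F : MultilinearMap ℤ (fun _ : Fin k => M) M') :
    MultilinearMap ℤ (fun _ : Fin k => M) M' :=
  ∑ τ : Equiv.Perm (Fin k), F.domDomCongr τ

theorem symmSum_apply (F : MultilinearMap ℤ (fun _ : Fin k => M) M') (x : Fin k → M) :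
    F.symmSum x = ∑ τ : Equiv.Perm (Fin k), F fun i => x (τ i) := by
  simp [symmSum]

theorem symmSum_const (F : MultilinearMap ℤ (fun _ : Fin k => M) M') (x : M) :
    F.symmSum (fun _ => x) = k.factorial • F fun _ => x := by
  simp [symmSum_apply, Fintype.card_perm]

/-- Linearization of the identity `B (F (x, …, x)) x = 0`. -/
theorem symmSum_linearization (F : MultilinearMap ℤ (fun _ : Fin k => M) M')
    (B : M' →ₗ[ℤ] M →ₗ[ℤ] N) (h : ∀ x, B (F fun _ => x) x = 0) (y : Fin k → M) (z : M) :
    B (F.symmSum y) z + ∑ j, B (F.symmSum (Function.update y j z)) (y j) = 0 := by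
  classical
  set R : Fin (k + 1) → M := Fin.cons z y with hR
  have key := (F.consPair B).map_const_sum_eq_sum_surjective R
    fun S _ => by rw [consPair_apply]; exact h _
  rw [consPair_apply, h] at key
  have perm : ∑ g : Fin (k + 1) → Fin (k + 1) with univ.image g = univ, F.consPair B (R ∘ g) =
      ∑ σ : Equiv.Perm (Fin (k + 1)), F.consPair B (R ∘ σ) := by
    symm
    refine sum_bij (fun σ _ => σ) ?_ ?_ ?_ fun _ _ => rfl
    · intro σ _
      simp [image_univ_of_surjective σ.surjective]
    · intro σ _ τ _ hst
      exact DFunLike.coe_injective hst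
    · intro g hg
      have hs : Function.Surjective g := by
        intro b
        have : b ∈ univ.image g := by rw [(mem_filter.1 hg).2]; exact mem_univ b
        simpa using this
      exact ⟨Equiv.ofBijective g (Finite.surjective_iff_bijective.1 hs), mem_univ _, rfl⟩
  rw [perm, ← Equiv.Perm.decomposeFin.symm.sum_comp, Fintype.sum_prod_type,
    Fin.sum_univ_succ] at key
  rw [key]
  congr 1
  · rw [symmSum_apply, _root_.map_sum, LinearMap.sum_apply]
    refine sum_congr rfl fun τ _ => ?_
    simp [consPair_apply, hR, Equiv.Perm.decomposeFin_symm_apply_succ]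
  · refine sum_congr rfl fun j _ => ?_
    rw [symmSum_apply, _root_.map_sum, LinearMap.sum_apply]
    refine sum_congr rfl fun τ _ => ?_
    rw [consPair_apply]
    simp only [Function.comp_apply, Equiv.Perm.decomposeFin_symm_apply_succ,
      Equiv.Perm.decomposeFin_symm_apply_zero, hR, Fin.cons_succ]
    congr 2
    refine congrArg F (funext fun i => ?_)
    by_cases hi : τ i = j
    · simp [hi]
    · rw [Equiv.swap_apply_of_ne_of_ne (Fin.succ_ne_zero _) (by simpa using hi)]
      simp [hi]

end MultilinearMap

section Matrix

variable {K : Type*} [Field K] {n : ℕ}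

theorem sum_single_one_mul (x : Matrix (Fin n) (Fin n) K) :
    ∑ i, single i i (1 : K) * x = x := by
  rw [← sum_mul, Matrix.sum_single_one, one_mul]

theorem sum_mul_single_one (x : Matrix (Fin n) (Fin n) K) :
    ∑ i, x * single i i (1 : K) = x := by
  rw [← mul_sum, Matrix.sum_single_one, mul_one]

theorem exists_forall_ne_of_lt {k : ℕ} (hk : k < n) (p : Fin k → Fin n) : ∃ r, ∀ i, p i ≠ r := by
  by_contra! h
  have := Fintype.card_le_of_surjective p h
  simp at this
  omega

/-- If `B(x, …, x) x = 0` for a multiadditive map `B` of degree less than `n`, then the trace of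
`B` vanishes up to a factorial. -/
theorem factorial_smul_const_eq_zero {k : ℕ} (hk : k < n)
    (B : MultilinearMap ℤ (fun _ : Fin k => Matrix (Fin n) (Fin n) K) (Matrix (Fin n) (Fin n) K))
    (h : ∀ x, B (fun _ => x) * x = 0) (x : Matrix (Fin n) (Fin n) K) :
    k.factorial • B (fun _ => x) = 0 := by
  rw [← B.symmSum_const]
  have hx := B.symmSum.map_sum (fun (_ : Fin k) i => x * single i i (1 : K))
  simp only [sum_mul_single_one] at hx
  rw [hx]
  refine sum_eq_zero fun q _ => ?_
  obtain ⟨s, hs⟩ := exists_forall_ne_of_lt hk q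
  ext a t
  have key := B.symmSum_linearization (LinearMap.mul ℤ _) (by simpa using h)
    (fun j => x * single (q j) (q j) (1 : K)) (single t s 1)
  have := congrFun (congrFun key a) s
  simp only [LinearMap.mul_apply', Matrix.add_apply, Matrix.sum_apply, Matrix.zero_apply] at this
  rw [sum_eq_zero] at this
  · simpa using this
  · intro j _
    rw [← mul_assoc, mul_single_apply_of_ne _ _ _ _ _ (hs j).symm]

/-- The rows of the symmetrization of a commuting multiadditive map at arguments whose `r`-th rows
vanish. -/
theorem symmSum_apply_of_row_eq_zero {k : ℕ}
    (F : MultilinearMap ℤ (fun _ : Fin k => Matrix (Fin n) (Fin n) K) (Matrix (Fin n) (Fin n) K))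
    (h : ∀ x, F (fun _ => x) * x - x * F (fun _ => x) = 0)
    (y : Fin k → Matrix (Fin n) (Fin n) K) (r : Fin n) (hr : ∀ j s, y j r s = 0) (t s : Fin n) :
    F.symmSum y t s = (F.symmSum y r r • (1 : Matrix (Fin n) (Fin n) K)) t s +
      ∑ j, (F.symmSum (Function.update y j (single r t 1)) * y j) r s := by
  have key := F.symmSum_linearization (LinearMap.mul ℤ _ - (LinearMap.mul ℤ _).flip)
    (by simpa using h) y (single r t 1)
  have := congrFun (congrFun key r) s
  simp only [LinearMap.sub_apply, LinearMap.mul_apply', LinearMap.flip_apply, Matrix.add_apply,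
    Matrix.sum_apply, Matrix.sub_apply, Matrix.zero_apply, single_mul_apply_same, one_mul] at this
  have hz : ∀ j, (y j * F.symmSum (Function.update y j (single r t 1))) r s = 0 := fun j => by
    rw [mul_apply]
    exact sum_eq_zero fun i _ => by rw [hr, zero_mul]
  have hd : (F.symmSum y * single r t (1 : K)) r s =
      (F.symmSum y r r • (1 : Matrix (Fin n) (Fin n) K)) t s := by
    by_cases hts : t = s
    · subst hts
      simp
    · rw [mul_single_apply_of_ne _ _ _ _ _ (Ne.symm hts)]
      simp [hts]
  simp only [hz, sub_zero, hd] at this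
  linear_combination -this

/-- A commuting multiadditive map of degree `k + 1 < n` has trace `Λ(x, …, x) + P(x, …, x) x` with
`Λ` scalar-valued and `P` of degree `k`, up to a factorial. -/
theorem exists_factorial_smul_eq_add_mul {k : ℕ} (hk : k + 1 < n)
    (F : MultilinearMap ℤ (fun _ : Fin (k + 1) => Matrix (Fin n) (Fin n) K)
      (Matrix (Fin n) (Fin n) K))
    (h : ∀ x, F (fun _ => x) * x - x * F (fun _ => x) = 0) :
    ∃ (Λ : MultilinearMap ℤ (fun _ : Fin (k + 1) => Matrix (Fin n) (Fin n) K) K)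
      (P : MultilinearMap ℤ (fun _ : Fin k => Matrix (Fin n) (Fin n) K)
        (Matrix (Fin n) (Fin n) K)),
      ∀ x, (k + 1).factorial • F (fun _ => x) = Λ (fun _ => x) • 1 + P (fun _ => x) * x := by
  choose r hr using fun p : Fin (k + 1) → Fin n => exists_forall_ne_of_lt hk p
  let e (i : Fin n) : Matrix (Fin n) (Fin n) K →ₗ[ℤ] Matrix (Fin n) (Fin n) K :=
    LinearMap.mulLeft ℤ (single i i (1 : K))
  refine ⟨∑ p : Fin (k + 1) → Fin n, (entryLinearMap ℤ K (r p) (r p)).compMultilinearMap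
      (F.symmSum.compLinearMap fun j => e (p j)),
    ∑ j, ∑ p' : Fin n, ∑ p : Fin k → Fin n, ∑ t,
      ((singleLinearMap ℤ t p').comp
        (entryLinearMap ℤ K (r (j.insertNth p' p)) p')).compMultilinearMap
      ((F.symmSum.curryMid j (single (r (j.insertNth p' p)) t 1)).compLinearMap fun i => e (p i)),
    fun x => ?_⟩
  rw [← F.symmSum_const]
  have hx := F.symmSum.map_sum (fun (_ : Fin (k + 1)) i => single i i (1 : K) * x)
  simp only [sum_single_one_mul] at hx
  rw [hx]
  ext a s
  have hrow := fun p : Fin (k + 1) → Fin n => symmSum_apply_of_row_eq_zero F h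
    (fun j => single (p j) (p j) (1 : K) * x) (r p)
    (fun j s => single_mul_apply_of_ne _ _ _ _ _ (hr p j).symm _) a s
  rw [Matrix.sum_apply, sum_congr rfl fun p _ => hrow p, sum_add_distrib, Matrix.add_apply]
  congr 1
  · simp [e, Finset.sum_mul]
  · rw [sum_comm]
    simp only [_root_.sum_apply, sum_mul, Matrix.sum_apply]
    refine sum_congr rfl fun j _ => ?_
    rw [← (Fin.insertNthEquiv (fun _ => Fin n) j).sum_comp, Fintype.sum_prod_type]
    refine sum_congr rfl fun p' _ => sum_congr rfl fun p _ => ?_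
    have hup : ∀ z, Function.update (fun i => single
        (Fin.insertNthEquiv (fun _ => Fin n) j (p', p) i)
        (Fin.insertNthEquiv (fun _ => Fin n) j (p', p) i) (1 : K) * x) j z =
        j.insertNth z fun i => single (p i) (p i) (1 : K) * x := by
      intro z
      funext i
      cases i using Fin.succAboveCases j <;> simp
    rw [hup, show Fin.insertNthEquiv (fun _ => Fin n) j (p', p) = j.insertNth p' p from rfl,
      Fin.insertNth_apply_same, sum_eq_single a]
    · rw [mul_apply, sum_eq_single p']
      · simp [e]
      · intro b _ hb
        rw [single_mul_apply_of_ne _ _ _ _ _ hb, mul_zero]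
      · simp
    · intro b _ hb
      simp [single_mul_apply_of_ne _ _ _ _ _ hb.symm]
    · simp

/-- A function is the trace of an `i`-multiadditive map. -/
def IsMultiadditiveTrace {M N : Type*} [AddCommGroup M] [AddCommGroup N] (i : ℕ) (f : M → N) :
    Prop :=
  ∃ T : MultilinearMap ℤ (fun _ : Fin i => M) N, ∀ x, f x = T fun _ => x

theorem IsMultiadditiveTrace.const_mul {M : Type*} [AddCommGroup M] {i : ℕ} {f : M → K}
    (hf : IsMultiadditiveTrace i f) (c : K) : IsMultiadditiveTrace i fun x => c * f x := by
  obtain ⟨T, hT⟩ := hf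
  exact ⟨(LinearMap.mulLeft ℤ c).compMultilinearMap T, fun x => by simp [hT]⟩

/-- The standard form of commuting traces of multiadditive maps on matrices. -/
theorem exists_eq_sum_smul_pow_of_commuting {k : ℕ} (hk : k < n) (hfac : (k.factorial : K) ≠ 0)
    (F : MultilinearMap ℤ (fun _ : Fin k => Matrix (Fin n) (Fin n) K) (Matrix (Fin n) (Fin n) K))
    (h : ∀ x, F (fun _ => x) * x - x * F (fun _ => x) = 0) :
    ∃ μ : ℕ → Matrix (Fin n) (Fin n) K → K, (∀ i, IsMultiadditiveTrace i (μ i)) ∧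
      ∀ x, F (fun _ => x) = ∑ i ∈ range (k + 1), μ i x • x ^ (k - i) := by
  induction k with
  | zero =>
    have hconst : ∀ x, (fun _ : Fin 0 => x) = (0 : Fin 0 → Matrix (Fin n) (Fin n) K) :=
      fun x => Subsingleton.elim _ _
    have hc : F 0 ∈ Set.range (Matrix.scalar (Fin n)) := by
      refine mem_range_scalar_of_commute_single fun i j _ => ?_
      have := h (single i j 1)
      rw [hconst, sub_eq_zero] at this
      exact this.symm
    obtain ⟨c, hc⟩ := hc
    refine ⟨fun i x => if i = 0 then c else 0, fun i => ?_, fun x => ?_⟩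
    · by_cases hi : i = 0
      · subst hi
        exact ⟨MultilinearMap.constOfIsEmpty ℤ _ c, fun x => by simp⟩
      · exact ⟨0, fun x => by simp [hi]⟩
    · rw [hconst, ← hc]
      simp [smul_one_eq_diagonal]
  | succ k ih =>
    obtain ⟨Λ, P, hP⟩ := exists_factorial_smul_eq_add_mul hk F h
    have hfac' : (k.factorial : K) ≠ 0 := by
      rw [Nat.factorial_succ, Nat.cast_mul] at hfac
      exact right_ne_zero_of_mul hfac
    let B : MultilinearMap ℤ (fun _ : Fin (k + 1) => Matrix (Fin n) (Fin n) K)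
        (Matrix (Fin n) (Fin n) K) :=
      P.consPair (LinearMap.mul ℤ _ - (LinearMap.mul ℤ _).flip)
    have hB : ∀ x, B (fun _ => x) = P (fun _ => x) * x - x * P (fun _ => x) := fun x => by
      simp [B, MultilinearMap.consPair_apply]
    have hcomm : ∀ x, P (fun _ => x) * x - x * P (fun _ => x) = 0 := by
      intro x
      have hz := factorial_smul_const_eq_zero hk B (fun x => by
        have hx := h x
        have hPx : P (fun _ => x) * x = (k + 1).factorial • F (fun _ => x) -
            Λ (fun _ => x) • 1 := by rw [hP, add_sub_cancel_left]
        rw [hB, sub_mul, mul_assoc x, hPx]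
        simp only [sub_mul, mul_sub, smul_mul_assoc, mul_smul_comm, one_mul, mul_one]
        rw [sub_sub_sub_cancel_right, ← smul_sub, hx, smul_zero]) x
      rw [hB, ← Nat.cast_smul_eq_nsmul K] at hz
      exact (smul_eq_zero.1 hz).resolve_left hfac
    obtain ⟨μ, hμ, hform⟩ := ih (by omega) hfac' P hcomm
    refine ⟨fun i x => ((k + 1).factorial : K)⁻¹ *
      (if i = k + 1 then Λ (fun _ => x) else μ i x), fun i => ?_, fun x => ?_⟩
    · refine IsMultiadditiveTrace.const_mul ?_ _
      by_cases hi : i = k + 1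
      · subst hi
        exact ⟨Λ, fun x => by simp⟩
      · simpa [hi] using hμ i
    · have hx := hP x
      rw [← Nat.cast_smul_eq_nsmul K, hform] at hx
      rw [← inv_smul_smul₀ hfac (F fun _ => x), hx, sum_range_succ _ (k + 1), smul_add, add_comm]
      congr 1
      · rw [sum_mul, smul_sum]
        refine sum_congr rfl fun i hi => ?_
        have hik := mem_range.1 hi
        beta_reduce
        rw [if_neg (by omega), smul_mul_assoc, ← pow_succ, smul_smul,
          show k - i + 1 = k + 1 - i by omega]
      · simp [smul_smul]

/-- A multiadditive map of degree at most `n` whose trace vanishes on singular matrices has a trace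
that is invariant under adding one row to another. -/
theorem map_const_transvection_mul {k : ℕ} {N : Type*} [AddCommGroup N] (hk : k ≤ n)
    (f : MultilinearMap ℤ (fun _ : Fin k => Matrix (Fin n) (Fin n) K) N)
    (h : ∀ x, ¬ IsUnit x → f (fun _ => x) = 0) {i j : Fin n} (hij : i ≠ j)
    (x : Matrix (Fin n) (Fin n) K) :
    f (fun _ => (1 + single i j 1) * x) = f fun _ => x := by
  have singular : ∀ (w x : Matrix (Fin n) (Fin n) K) (u : Fin n), w * single u u 1 = 0 →
      ¬ IsUnit (w * x) := by
    intro w x u hw hu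
    have hwu := isUnit_of_mul_isUnit_left hu
    have := hwu.mul_right_eq_zero.1 hw
    simpa using congrFun (congrFun this u) u
  have expand : ∀ x, f (fun _ => x) = ∑ g : Fin k → Fin n with univ.image g = univ,
      f ((fun u => single u u 1 * x) ∘ g) := by
    intro x
    rw [← f.map_const_sum_eq_sum_surjective, sum_single_one_mul]
    intro S hS
    obtain ⟨u, hu⟩ : ∃ u, u ∉ S := by
      by_contra! hall
      exact hS (eq_univ_of_forall hall)
    rw [← sum_mul]
    refine h _ (singular _ _ u ?_)
    rw [sum_mul]
    refine sum_eq_zero fun v hv => ?_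
    rw [single_mul_single_of_ne]
    rintro rfl
    exact hu hv
  set R : Fin n → Matrix (Fin n) (Fin n) K := fun u => single u u 1 * x with hR
  set v := single i j (1 : K) * x with hv
  have row_add : (fun u => single u u 1 * ((1 + single i j 1) * x)) =
      Function.update R i (R i + v) := by
    funext u
    by_cases hu : u = i
    · subst hu
      simp [hR, hv, add_mul, mul_add, ← mul_assoc]
    · simp [hu, hR, add_mul, mul_add, ← mul_assoc]
  have row_replace : (fun u => single u u 1 * ((1 - single i i 1 + single i j 1) * x)) =
      Function.update R i v := by
    funext u
    by_cases hu : u = i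
    · subst hu
      simp [hv, add_mul, sub_mul, mul_add, mul_sub, ← mul_assoc]
    · simp [hu, hR, add_mul, sub_mul, mul_add, mul_sub, ← mul_assoc]
  have hzero : f (fun _ => (1 - single i i 1 + single i j 1) * x) = 0 := by
    refine h _ (singular _ _ i ?_)
    simp [add_mul, sub_mul, single_mul_single_of_ne _ _ _ _ hij.symm]
  rw [expand, row_replace] at hzero
  rw [expand, expand x, row_add, ← add_zero (∑ g with _, f ((fun u => single u u 1 * x) ∘ g)),
    ← hzero, ← sum_add_distrib]
  refine sum_congr rfl fun g hg => ?_
  have hs : Function.Surjective g := by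
    intro b
    have : b ∈ univ.image g := by rw [(mem_filter.1 hg).2]; exact mem_univ b
    simpa using this
  have hinj : Function.Injective g := (hs.bijective_of_nat_card_le (by simpa using hk)).1
  obtain ⟨l, rfl⟩ := hs i
  simp only [Function.update_comp_eq_of_injective _ hinj]
  rw [f.map_update_add]
  congr 1
  rw [show R (g l) = (R ∘ g) l from rfl, Function.update_eq_self]

/-- A multiadditive map of degree less than `n` commuting on singular matrices commutes on all
matrices. -/
theorem commuting_of_commuting_on_singular {m : ℕ} (hm : m + 1 ≤ n) (hn : 2 ≤ n)
    (F : MultilinearMap ℤ (fun _ : Fin m => Matrix (Fin n) (Fin n) K) (Matrix (Fin n) (Fin n) K))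
    (h : ∀ x, ¬ IsUnit x → F (fun _ => x) * x - x * F (fun _ => x) = 0)
    (x : Matrix (Fin n) (Fin n) K) :
    F (fun _ => x) * x - x * F (fun _ => x) = 0 := by
  by_cases hx : ¬ IsUnit x
  · exact h x hx
  rw [not_not] at hx
  let A : MultilinearMap ℤ (fun _ : Fin (m + 1) => Matrix (Fin n) (Fin n) K)
      (Matrix (Fin n) (Fin n) K) :=
    F.consPair (LinearMap.mul ℤ _ - (LinearMap.mul ℤ _).flip)
  have hA : ∀ x, A (fun _ => x) = F (fun _ => x) * x - x * F (fun _ => x) := fun x => by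
    simp [A, MultilinearMap.consPair_apply]
  have inv : ∀ {i j : Fin n}, i ≠ j → ∀ x, A (fun _ => (1 + single i j 1) * x) = A fun _ => x :=
    fun hij x => map_const_transvection_mul hm A (fun x hx => by rw [hA, h x hx]) hij x
  have htr : ∀ x, (x * A fun _ => x).trace = 0 := by
    intro x
    rw [hA, mul_sub, trace_sub, ← mul_assoc, trace_mul_comm (x * _), sub_self]
  have hoff : ∀ {i j : Fin n}, i ≠ j → ∀ x, (x * A fun _ => x) j i = 0 := by
    intro i j hij x
    have := htr ((1 + single i j 1) * x)
    rw [inv hij, mul_assoc, add_mul, one_mul, trace_add, htr, zero_add] at this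
    simpa [trace_single_mul] using this
  have hdiag : x * A (fun _ => x) = 0 := by
    ext i j
    by_cases hij : i = j
    · subst hij
      have : Nontrivial (Fin n) := Fin.nontrivial_iff_two_le.2 hn
      obtain ⟨l, hl⟩ := exists_ne i
      have := hoff hl.symm ((1 + single l i 1) * x)
      rw [inv hl, mul_assoc, add_mul, one_mul, Matrix.add_apply, hoff hl.symm,
        single_mul_apply_same, one_mul, zero_add] at this
      exact this
    · exact hoff (Ne.symm hij) x
  rw [← hA]
  exact hx.mul_right_eq_zero.1 hdiag

end Matrix

theorem natCast_factorial_ne_zero_of_ringChar {K : Type*} [Field K] {m : ℕ}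
    (h : ringChar K = 0 ∨ m < ringChar K) : (m.factorial : K) ≠ 0 := by
  intro h0
  have hdvd := (ringChar.spec K _).1 h0
  rcases h with h | h
  · rw [h, zero_dvd_iff] at hdvd
    exact m.factorial_ne_zero hdvd
  · have hp : (ringChar K).Prime :=
      (CharP.char_is_prime_or_zero K (ringChar K)).resolve_right (by omega)
    exact absurd ((hp.dvd_factorial).1 hdvd) (by omega)

end CommutingTrace

/-- If `G` is a symmetric `m`-additive map whose trace commutes on all
singular (non-invertible) matrices, then the trace of `G` has the form
`G(x,…,x) = μ₀ • x^m + Σ_{i=1}^{m} μ_i(x) • x^{m-i}`, where `μ₀ ∈ Z` and each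
`μ_i : M_n(K) → Z` is the trace of an `i`-additive map into the center `Z = K • I`. -/
theorem stmt_14 (K : Type*) [Field K] (m n : ℕ) (hm : 1 < m) (hn : m + 1 ≤ n)
    (hchar : ringChar K = 0 ∨ m + 1 < ringChar K)
    (hcard : ((m + 4 : ℕ) : Cardinal) ≤ Cardinal.mk K)
    
    (G : (Fin m → Matrix (Fin n) (Fin n) K) → Matrix (Fin n) (Fin n) K)
    (hadd : ∀ (x : Fin m → Matrix (Fin n) (Fin n) K) (r : Fin m)
      (a b : Matrix (Fin n) (Fin n) K),
      G (Function.update x r (a + b)) = G (Function.update x r a) + G (Function.update x r b))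
    (hsymm : ∀ (σ : Equiv.Perm (Fin m)) (x : Fin m → Matrix (Fin n) (Fin n) K),
      G (x ∘ σ) = G x)
    (hcomm : ∀ x : Matrix (Fin n) (Fin n) K, ¬ IsUnit x →
      G (fun _ => x) * x - x * G (fun _ => x) = 0) :
    ∃ (μ0 : K) (μ : Fin m → Matrix (Fin n) (Fin n) K → K),
      (∀ i : Fin m, ∃ T : (Fin ((i : ℕ) + 1) → Matrix (Fin n) (Fin n) K) → K,
        MultiAdditive T ∧ ∀ x, μ i x = T (fun _ => x)) ∧
      ∀ x : Matrix (Fin n) (Fin n) K,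
        G (fun _ => x) = μ0 • x ^ m + ∑ i : Fin m, μ i x • x ^ (m - ((i : ℕ) + 1)) := by
  have hn2 : 2 ≤ n := by omega
  let F : MultilinearMap ℤ (fun _ : Fin m => Matrix (Fin n) (Fin n) K)
      (Matrix (Fin n) (Fin n) K) :=
    { toFun := G
      map_update_add' := fun {inst} x r a b => by
        obtain rfl := Subsingleton.elim (instDecidableEqFin m) inst
        exact hadd x r a b
      map_update_smul' := fun {inst} x r c a => by
        obtain rfl := Subsingleton.elim (instDecidableEqFin m) inst
        exact map_zsmul (AddMonoidHom.mk' (fun a => G (Function.update x r a)) (hadd x r)) c a }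
  have hF : ∀ x, F (fun _ => x) = G fun _ => x := fun _ => rfl
  obtain ⟨μ, hμ, hform⟩ := exists_eq_sum_smul_pow_of_commuting (by omega)
    (natCast_factorial_ne_zero_of_ringChar (hchar.imp_right (by omega))) F
    (commuting_of_commuting_on_singular hn hn2 F hcomm)
  refine ⟨μ 0 0, fun i => μ (i + 1), fun i => ?_, fun x => ?_⟩
  · obtain ⟨T, hT⟩ := hμ (i + 1)
    exact ⟨T, fun x r a b => T.map_update_add x r a b, hT⟩
  · obtain ⟨T, hT⟩ := hμ 0
    have h0 : μ 0 x = μ 0 0 := by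
      rw [hT, hT]
      exact congrArg T (Subsingleton.elim _ _)
    rw [← hF, hform, Finset.sum_range_succ', add_comm, h0, Nat.sub_zero, Finset.sum_range]
end
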